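/- arXiv:1102.2141 — 3 statements merged into one kernel-verified Lean document; each statement's English description precedes it below -/
import Mathlib

section
/- For every integer n ≥ 1, the maximum number of edges in an F_{3,3}-free 3-graph on n vertices equals b(n), except when n = 5, in which case the maximum equals 10. -/
/-- `G` contains a copy of `F₃,₃`: six distinct vertices `a b c x y z` such that
`{a,b,c}` and all nine triples with one vertex in `{a,b,c}` and two in `{x,y,z}`
are edges of `G`. -/
def HasF33 {V : Type*} [DecidableEq V] (G : Finset (Finset V)) : Prop :=
  ∃ a b c x y z : V, ({a, b, c, x, y, z} : Finset V).card = 6 ∧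
    ({a, b, c} : Finset V) ∈ G ∧
    ({a, x, y} : Finset V) ∈ G ∧ ({a, x, z} : Finset V) ∈ G ∧ ({a, y, z} : Finset V) ∈ G ∧
    ({b, x, y} : Finset V) ∈ G ∧ ({b, x, z} : Finset V) ∈ G ∧ ({b, y, z} : Finset V) ∈ G ∧
    ({c, x, y} : Finset V) ∈ G ∧ ({c, x, z} : Finset V) ∈ G ∧ ({c, y, z} : Finset V) ∈ G

def F33Free {V : Type*} [DecidableEq V] (G : Finset (Finset V)) : Prop := ¬ HasF33 G

/-- `b n = C(n,3) - C(⌊n/2⌋,3) - C(⌈n/2⌉,3)`. -/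
def b (n : ℕ) : ℕ := n.choose 3 - (n / 2).choose 3 - ((n + 1) / 2).choose 3

open Finset in
/-- Sum of `f` over the `k`-subsets of `U`. -/
def SS {V : Type*} [DecidableEq V] (k : ℕ) (f : Finset V → ℕ) (U : Finset V) : ℕ :=
  ∑ e ∈ powersetCard k U, f e

namespace F33proof

open Finset

variable {V : Type*} [DecidableEq V]

lemma SS_insert (k : ℕ) (f : Finset V → ℕ) {v : V} {U : Finset V} (hv : v ∉ U) :
    SS (k+1) f (insert v U) = SS (k+1) f U + SS k (fun p => f (insert v p)) U := by
  unfold SS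
  rw [powersetCard_succ_insert hv, sum_union, sum_image]
  · intro x hx y hy hxy
    simp only [mem_coe, mem_powersetCard] at hx hy
    have h1 : v ∉ x := fun h => hv (hx.1 h)
    have h2 : v ∉ y := fun h => hv (hy.1 h)
    rw [← erase_insert h1, ← erase_insert h2, hxy]
  · rw [disjoint_left]
    intro e he he'
    rw [mem_image] at he'
    obtain ⟨p, _, rfl⟩ := he'
    exact hv ((mem_powersetCard.1 he).1 (mem_insert_self _ _))

lemma SS_one (f : Finset V → ℕ) (U : Finset V) : SS 1 f U = ∑ x ∈ U, f {x} := by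
  unfold SS
  rw [powersetCard_one, sum_map]
  rfl

lemma SS_empty (k : ℕ) (f : Finset V → ℕ) : SS (k+1) f ∅ = 0 := by
  unfold SS
  rw [powersetCard_eq_empty.2 (by simp)]
  simp

lemma SS2_insert (f : Finset V → ℕ) {v : V} {U : Finset V} (hv : v ∉ U) :
    SS 2 f (insert v U) = SS 2 f U + ∑ x ∈ U, f {v, x} := by
  rw [SS_insert 1 f hv, SS_one]

lemma SS_le (k : ℕ) (f : Finset V → ℕ) (U : Finset V) (hf : ∀ e, f e ≤ 1) :
    SS k f U ≤ (#U).choose k := by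
  unfold SS
  calc _ ≤ ∑ e ∈ powersetCard k U, 1 := sum_le_sum (fun e _ => hf e)
    _ = _ := by simp

lemma SS_add (k : ℕ) (f g : Finset V → ℕ) (U : Finset V) :
    SS k (fun p => f p + g p) U = SS k f U + SS k g U := by
  unfold SS; exact sum_add_distrib

/-- deletion averaging -/
lemma SS_avg (k : ℕ) (f : Finset V → ℕ) (U : Finset V) :
    ∑ v ∈ U, SS k f (U.erase v) + k * SS k f U = #U * SS k f U := by
  have h : ∀ v ∈ U, SS k f (U.erase v) = ∑ e ∈ powersetCard k U, if v ∈ e then 0 else f e := by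
    intro v _
    unfold SS
    have : powersetCard k (U.erase v) = (powersetCard k U).filter (fun e => v ∉ e) := by
      ext e
      simp only [mem_powersetCard, mem_filter, subset_erase]
      tauto
    rw [this, sum_filter]
    apply sum_congr rfl
    intro e _
    by_cases hv : v ∈ e <;> simp [hv]
  rw [sum_congr rfl h, sum_comm]
  unfold SS
  rw [mul_sum, mul_sum, ← sum_add_distrib]
  apply sum_congr rfl
  intro e he
  rw [mem_powersetCard] at he
  have h2 : ∑ v ∈ U, (if v ∈ e then 0 else f e) = #(U \ e) * f e := by
    rw [sum_ite, filter_notMem_eq_sdiff]; simp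
  rw [h2, ← add_mul, ← he.2, card_sdiff_add_card_eq_card he.1]

lemma SS2_union (h : Finset V → ℕ) (S X : Finset V) (hd : Disjoint S X) :
    SS 2 h (S ∪ X) = SS 2 h S + SS 2 h X + ∑ s ∈ S, ∑ x ∈ X, h {s, x} := by
  induction S using Finset.induction_on with
  | empty => simp [SS_empty]
  | insert a S ha ih =>
    rw [disjoint_insert_left] at hd
    have h1 : a ∉ S ∪ X := by simp [ha, hd.1]
    rw [insert_union, SS2_insert h h1, ih hd.2, SS2_insert h ha, sum_insert ha,
      sum_union hd.2]
    ring

lemma SS3_union (f : Finset V → ℕ) (S X : Finset V) (hd : Disjoint S X) :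
    SS 3 f (S ∪ X) = SS 3 f S + SS 3 f X + ∑ x ∈ X, SS 2 (fun p => f (insert x p)) S
      + SS 2 (fun p => ∑ s ∈ S, f (insert s p)) X := by
  induction S using Finset.induction_on with
  | empty => simp [SS_empty]; simp [SS]
  | insert a S ha ih =>
    rw [disjoint_insert_left] at hd
    have h1 : a ∉ S ∪ X := by simp [ha, hd.1]
    rw [insert_union, SS_insert 2 f h1, ih hd.2, SS_insert 2 f ha, SS2_union _ _ _ hd.2]
    have e1 : SS 2 (fun p => ∑ s ∈ insert a S, f (insert s p)) X =
        SS 2 (fun p => f (insert a p)) X + SS 2 (fun p => ∑ s ∈ S, f (insert s p)) X := by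
      rw [← SS_add]
      congr 1
      ext p
      rw [sum_insert ha]
    have e2 : ∑ x ∈ X, SS 2 (fun p => f (insert x p)) (insert a S) =
        ∑ x ∈ X, SS 2 (fun p => f (insert x p)) S + ∑ s ∈ S, ∑ x ∈ X, f (insert a {s, x}) := by
      rw [sum_comm, ← sum_add_distrib]
      apply sum_congr rfl
      intro x _
      rw [SS2_insert _ ha]
      congr 1
      apply sum_congr rfl
      intro s _
      congr 1
      ext y
      simp only [mem_insert, mem_singleton]
      tauto
    rw [e1, e2]
    ring

lemma c2 (m : ℕ) : 2 * m.choose 2 + m = m * m := by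
  induction m with
  | zero => rfl
  | succ m ih =>
    have := Nat.choose_succ_succ m 1
    simp at this
    rw [this]; nlinarith

lemma c3 (m : ℕ) : 6 * m.choose 3 + 3 * (m * m) = m * m * m + 2 * m := by
  induction m with
  | zero => rfl
  | succ m ih =>
    have := Nat.choose_succ_succ m 2
    simp only [Nat.succ_eq_add_one] at this
    have h2 := c2 m
    simp at this
    rw [this]; nlinarith

lemma b_even (m : ℕ) : b (2 * m) + m * m = m * m * m := by
  unfold b
  have h1 : 2 * m / 2 = m := by omega
  have h2 : (2 * m + 1) / 2 = m := by omega
  rw [h1, h2]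
  have h3 := c3 m
  have h4 := c3 (2 * m)
  have h5 : (2*m).choose 3 + m * m = 2 * m.choose 3 + m * m * m := by nlinarith
  have h6 : m * m ≤ m * m * m := by nlinarith [Nat.le_mul_self m]
  omega

lemma b_odd (m : ℕ) : 2 * b (2 * m + 1) + m = 2 * (m * m * m) + m * m := by
  unfold b
  have h1 : (2 * m + 1) / 2 = m := by omega
  have h2 : (2 * m + 1 + 1) / 2 = m + 1 := by omega
  rw [h1, h2]
  have h3 := c3 m
  have h7 := c3 (m+1)
  have h4 := c3 (2 * m + 1)
  have h5 : 2 * (2*m+1).choose 3 + m =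
    2 * m.choose 3 + 2 * (m+1).choose 3 + 2 * (m * m * m) + m * m := by nlinarith
  have h6 : m ≤ m * m := by nlinarith [Nat.le_mul_self m]
  omega

lemma b_step (n : ℕ) : b (n + 4) = b n + 4 + 5 * n + 3 * n.choose 2 + n / 2 := by
  rcases Nat.even_or_odd' n with ⟨m, rfl | rfl⟩
  · have h1 := b_even m
    have h2 := b_even (m + 2)
    rw [show 2 * (m+2) = 2 * m + 4 by ring] at h2
    have h3 := c2 (2 * m)
    have h4 : 2 * m / 2 = m := by omega
    rw [h4]
    nlinarith
  · have h1 := b_odd m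
    have h2 := b_odd (m + 2)
    rw [show 2 * (m+2) + 1 = 2 * m + 1 + 4 by ring] at h2
    have h3 := c2 (2 * m + 1)
    have h4 : (2 * m + 1) / 2 = m := by omega
    rw [h4]
    nlinarith

lemma b_dens (n : ℕ) : 3 * n.choose 3 ≤ 4 * b n := by
  have h3 := c3 n
  rcases Nat.even_or_odd' n with ⟨m, rfl | rfl⟩
  · have h1 := b_even m
    nlinarith [Nat.le_mul_self m]
  · have h1 := b_odd m
    nlinarith [Nat.le_mul_self m]

/-- multigraph lemma -/
lemma multi (w : Finset V → ℕ) (n : ℕ) : ∀ U : Finset V, #U = n →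
    (∀ x y, x ∈ U → y ∈ U → x ≠ y → w {x, y} ≤ 4) →
    (∀ x y z, x ∈ U → y ∈ U → z ∈ U → x ≠ y → x ≠ z → y ≠ z →
      w {x, y} + w {x, z} + w {y, z} ≤ 10) →
    SS 2 w U ≤ 3 * n.choose 2 + n / 2 := by
  induction n using Nat.strong_induction_on with
  | _ n ih =>
  intro U hU hw ht
  by_cases h : ∃ x y, x ∈ U ∧ y ∈ U ∧ x ≠ y ∧ 4 ≤ w {x, y}
  · obtain ⟨x, y, hx, hy, hxy, h4⟩ := h
    obtain ⟨U1, hx1, rfl⟩ : ∃ U1, x ∉ U1 ∧ insert x U1 = U :=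
      ⟨U.erase x, notMem_erase _ _, insert_erase hx⟩
    have hy1 : y ∈ U1 := by
      rcases mem_insert.1 hy with h | h
      · exact absurd h.symm hxy
      · exact h
    obtain ⟨X, hyX, rfl⟩ : ∃ X, y ∉ X ∧ insert y X = U1 :=
      ⟨U1.erase y, notMem_erase _ _, insert_erase hy1⟩
    have hxX : x ∉ X := fun h => hx1 (mem_insert_of_mem h)
    rw [SS2_insert w hx1, SS2_insert w hyX, sum_insert hyX]
    rw [card_insert_of_notMem hx1, card_insert_of_notMem hyX] at hU
    have hI := ih (#X) (by omega) X rfl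
      (fun p q hp hq => hw p q (by simp [hp]) (by simp [hq]))
      (fun p q r hp hq hr => ht p q r (by simp [hp]) (by simp [hq]) (by simp [hr]))
    have h6 : ∑ z ∈ X, w {x, z} + ∑ z ∈ X, w {y, z} ≤ 6 * #X := by
      rw [← sum_add_distrib, mul_comm, ← smul_eq_mul, ← sum_const]
      apply sum_le_sum
      intro z hz
      have := ht x y z hx hy (by simp [hz]) hxy (fun h => hxX (h ▸ hz)) (fun h => hyX (h ▸ hz))
      omega
    have h7 := hw x y hx hy hxy
    subst hU
    have h8 := c2 (#X)
    have h9 := c2 (#X + 1 + 1)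
    have h10 : (#X + 1 + 1) / 2 = #X / 2 + 1 := by omega
    rw [h10]
    nlinarith
  · push Not at h
    have : SS 2 w U ≤ ∑ e ∈ powersetCard 2 U, 3 := by
      apply sum_le_sum
      intro e he
      rw [mem_powersetCard, card_eq_two] at he
      obtain ⟨he, x, y, hxy, rfl⟩ := he
      have := h x y (he (by simp)) (he (by simp)) hxy
      omega
    rw [sum_const, card_powersetCard, hU, smul_eq_mul] at this
    omega

/-- edge indicator -/
def ind (G : Finset (Finset V)) (e : Finset V) : ℕ := if e ∈ G then 1 else 0

lemma ind_le (G : Finset (Finset V)) (e : Finset V) : ind G e ≤ 1 := by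
  unfold ind; split_ifs <;> simp

lemma ind_mem {G : Finset (Finset V)} {e : Finset V} (h : 1 ≤ ind G e) : e ∈ G := by
  unfold ind at h; by_contra h'; simp [h'] at h

def Complete (G : Finset (Finset V)) (S : Finset V) : Prop := ∀ e, e ⊆ S → #e = 3 → e ∈ G

lemma perm3 (a x y : V) : ({x, y, a} : Finset V) = {a, x, y} := by
  ext t; simp only [mem_insert, mem_singleton]; tauto

/-- the common link of a complete set has weight bounded on triangles -/
lemma tri {G : Finset (Finset V)} (hG : F33Free G) {S : Finset V} (hS : Complete G S)
    {x y z : V} (hx : x ∉ S) (hy : y ∉ S) (hz : z ∉ S) (hxy : x ≠ y) (hxz : x ≠ z) (hyz : y ≠ z) :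
    (∑ s ∈ S, ind G (insert s {x, y})) + (∑ s ∈ S, ind G (insert s {x, z})) +
      (∑ s ∈ S, ind G (insert s {y, z})) ≤ 2 * #S + 2 := by
  rw [← sum_add_distrib, ← sum_add_distrib]
  set t : V → ℕ := fun s => ind G (insert s {x, y}) + ind G (insert s {x, z}) +
    ind G (insert s {y, z}) with ht
  have hA : #(S.filter (fun s => t s = 3)) ≤ 2 := by
    by_contra hc
    push Not at hc
    obtain ⟨a, b, c, ha, hb, hc, hab, hac, hbc⟩ := two_lt_card_iff.1 hc
    rw [mem_filter] at ha hb hc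
    apply hG
    have key : ∀ s, t s = 3 → ({s, x, y} : Finset V) ∈ G ∧ ({s, x, z} : Finset V) ∈ G ∧
        ({s, y, z} : Finset V) ∈ G := by
      intro s hs
      have h1 := ind_le G (insert s {x, y})
      have h2 := ind_le G (insert s {x, z})
      have h3 := ind_le G (insert s {y, z})
      simp only [ht] at hs
      exact ⟨ind_mem (by omega), ind_mem (by omega), ind_mem (by omega)⟩
    have hax : ∀ s ∈ S, s ≠ x ∧ s ≠ y ∧ s ≠ z := fun s hs =>
      ⟨fun h => hx (h ▸ hs), fun h => hy (h ▸ hs), fun h => hz (h ▸ hs)⟩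
    obtain ⟨a1, a2, a3⟩ := hax a ha.1
    obtain ⟨b1, b2, b3⟩ := hax b hb.1
    obtain ⟨c1, c2, c3⟩ := hax c hc.1
    obtain ⟨ka1, ka2, ka3⟩ := key a ha.2
    obtain ⟨kb1, kb2, kb3⟩ := key b hb.2
    obtain ⟨kc1, kc2, kc3⟩ := key c hc.2
    refine ⟨a, b, c, x, y, z, ?_, hS _ ?_ ?_, ka1, ka2, ka3, kb1, kb2, kb3, kc1, kc2, kc3⟩
    · simp [*]
    · intro s hs
      simp only [mem_insert, mem_singleton] at hs
      rcases hs with rfl | rfl | rfl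
      exacts [ha.1, hb.1, hc.1]
    · simp [*]
  have h1 : ∑ s ∈ S, t s ≤ ∑ s ∈ S, (2 + if t s = 3 then 1 else 0) := by
    apply sum_le_sum
    intro s _
    have h1 := ind_le G (insert s {x, y})
    have h2 := ind_le G (insert s {x, z})
    have h3 := ind_le G (insert s {y, z})
    have h4 : t s ≤ 3 := by simp only [ht]; omega
    split_ifs <;> omega
  have h2 : ∑ s ∈ S, (2 + if t s = 3 then 1 else 0) = #S * 2 + #(S.filter (fun s => t s = 3)) := by
    rw [sum_add_distrib, sum_const, ← card_filter, smul_eq_mul]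
  change ∑ s ∈ S, t s ≤ _
  omega

/-- a vertex outside a complete 5-set sees at most 8 of its pairs -/
lemma five {G : Finset (Finset V)} (hG : F33Free G) {W : Finset V} (hW : Complete G W)
    (h5 : #W = 5) {u : V} (hu : u ∉ W) : SS 2 (fun p => ind G (insert u p)) W ≤ 8 := by
  by_contra hcon
  push Not at hcon
  set Z := (powersetCard 2 W).filter (fun p => insert u p ∉ G) with hZ
  have hsum : SS 2 (fun p => ind G (insert u p)) W + #Z = 10 := by
    rw [hZ, card_filter]
    unfold SS
    rw [← sum_add_distrib]
    have : ∀ p ∈ powersetCard 2 W, ind G (insert u p) + (if insert u p ∉ G then 1 else 0) = 1 := by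
      intro p _
      unfold ind
      by_cases h : insert u p ∈ G <;> simp [h]
    rw [sum_congr rfl this]
    simp [h5]
    decide
  have hZ1 : #Z ≤ 1 := by omega
  obtain ⟨p0, hp0, hp0Z⟩ : ∃ p0 ∈ powersetCard 2 W, Z ⊆ {p0} := by
    rcases Z.eq_empty_or_nonempty with h | ⟨q, hq⟩
    · obtain ⟨p, hp⟩ : (powersetCard 2 W).Nonempty := powersetCard_nonempty.2 (by omega)
      exact ⟨p, hp, by simp [h]⟩
    · exact ⟨q, (mem_filter.1 hq).1, fun r hr => by
        rw [mem_singleton]; exact card_le_one.1 hZ1 r hr q hq⟩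
  rw [mem_powersetCard, card_eq_two] at hp0
  obtain ⟨hsub, x, y, hxy, rfl⟩ := hp0
  have hc : #(W \ {x, y}) = 3 := by
    rw [card_sdiff_of_subset hsub, h5, card_pair hxy]
  obtain ⟨a, b, c, hab, hac, hbc, habc⟩ := card_eq_three.1 hc
  have hm : ∀ s ∈ ({a, b, c} : Finset V), s ∈ W ∧ s ≠ x ∧ s ≠ y ∧ s ≠ u := by
    intro s hs
    rw [← habc] at hs
    simp only [mem_sdiff, mem_insert, mem_singleton, not_or] at hs
    exact ⟨hs.1, hs.2.1, hs.2.2, fun h => hu (h ▸ hs.1)⟩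
  have hxW : x ∈ W := hsub (by simp)
  have hyW : y ∈ W := hsub (by simp)
  have hxu : x ≠ u := fun h => hu (h ▸ hxW)
  have hyu : y ≠ u := fun h => hu (h ▸ hyW)
  have in3 : ∀ p q r, p ∈ W → q ∈ W → r ∈ W → p ≠ q → p ≠ r → q ≠ r →
      ({p, q, r} : Finset V) ∈ G := by
    intro p q r hp hq hr h1 h2 h3
    apply hW
    · intro s hs
      simp only [mem_insert, mem_singleton] at hs
      rcases hs with rfl | rfl | rfl <;> assumption
    · simp [*]
  have out : ∀ s t, s ∈ W → t ∈ W → s ≠ t → s ≠ x → s ≠ y → ({s, t, u} : Finset V) ∈ G := by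
    intro s t hs ht hst hsx hsy
    by_contra hn
    have : ({s, t} : Finset V) ∈ Z := by
      rw [hZ, mem_filter, mem_powersetCard]
      refine ⟨⟨?_, card_pair hst⟩, ?_⟩
      · intro r hr
        simp only [mem_insert, mem_singleton] at hr
        rcases hr with rfl | rfl <;> assumption
      · rwa [← perm3]
    have h2 := mem_singleton.1 (hp0Z this)
    have h3 : s ∈ ({x, y} : Finset V) := h2 ▸ mem_insert_self _ _
    simp [hsx, hsy] at h3
  obtain ⟨a0, a1, a2, a3⟩ := hm a (by simp)
  obtain ⟨b0, b1, b2, b3⟩ := hm b (by simp)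
  obtain ⟨c0, c1, c2, c3⟩ := hm c (by simp)
  apply hG
  refine ⟨a, b, c, x, y, u, by simp [*], in3 _ _ _ a0 b0 c0 hab hac hbc, ?_, ?_, ?_, ?_, ?_, ?_,
    ?_, ?_, ?_⟩
  · exact in3 _ _ _ a0 hxW hyW a1 a2 hxy
  · exact out _ _ a0 hxW a1 a1 a2
  · exact out _ _ a0 hyW a2 a1 a2
  · exact in3 _ _ _ b0 hxW hyW b1 b2 hxy
  · exact out _ _ b0 hxW b1 b1 b2
  · exact out _ _ b0 hyW b2 b1 b2
  · exact in3 _ _ _ c0 hxW hyW c1 c2 hxy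
  · exact out _ _ c0 hxW c1 c1 c2
  · exact out _ _ c0 hyW c2 c1 c2

/-- if the edge count is maximal then the set is complete -/
lemma complete_of {G : Finset (Finset V)} {S : Finset V}
    (h : (#S).choose 3 ≤ SS 3 (ind G) S) : Complete G S := by
  intro e he h3
  by_contra hn
  have : SS 3 (ind G) S < ∑ e ∈ powersetCard 3 S, 1 := by
    apply sum_lt_sum (fun e _ => ind_le G e)
    exact ⟨e, mem_powersetCard.2 ⟨he, h3⟩, by simp [ind, hn]⟩
  simp at this
  omega

/-- adding a full vertex to a complete 4-set -/
lemma complete_insert {G : Finset (Finset V)} {S : Finset V} {x : V} (hx : x ∉ S)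
    (hS : Complete G S) (h4 : #S = 4) (h : 6 ≤ SS 2 (fun p => ind G (insert x p)) S) :
    Complete G (insert x S) := by
  apply complete_of
  rw [SS_insert 2 _ hx, card_insert_of_notMem hx, h4]
  have : SS 3 (ind G) S = ∑ e ∈ powersetCard 3 S, 1 := by
    apply sum_congr rfl
    intro e he
    rw [mem_powersetCard] at he
    simp [ind, hS e he.1 he.2]
  rw [this]
  have h5 : Nat.choose (4 + 1) 3 = 10 := by decide
  have h6 : Nat.choose 4 3 = 4 := by decide
  simp only [sum_const, card_powersetCard, h4, smul_eq_mul, h5, h6]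
  omega

/-- removing a complete 4-set -/
lemma step4 {G : Finset (Finset V)} (hG : F33Free G) {S X : Finset V} (hd : Disjoint S X)
    (hS : Complete G S) (h4 : #S = 4)
    (hsum : ∑ x ∈ X, SS 2 (fun p => ind G (insert x p)) S ≤ 5 * #X)
    (hX : SS 3 (ind G) X ≤ b (#X)) : SS 3 (ind G) (S ∪ X) ≤ b (#(S ∪ X)) := by
  rw [SS3_union _ _ _ hd, card_union_of_disjoint hd, h4, add_comm 4, b_step]
  have h1 := SS_le 3 (ind G) S (ind_le G)
  rw [h4, show Nat.choose 4 3 = 4 by decide] at h1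
  have hnot : ∀ x ∈ X, x ∉ S := fun x hx hs => disjoint_left.1 hd hs hx
  have h2 := multi (fun p => ∑ s ∈ S, ind G (insert s p)) (#X) X rfl
    (by
      intro x y _ _ _
      calc _ ≤ ∑ s ∈ S, 1 := sum_le_sum (fun s _ => ind_le G _)
        _ = 4 := by simp [h4])
    (by
      intro x y z hx hy hz hxy hxz hyz
      have := tri hG hS (hnot x hx) (hnot y hy) (hnot z hz) hxy hxz hyz
      rw [h4] at this
      exact this)
  omega

/-- four vertices, every triangle at most 12 -/
lemma four24 (w : Finset V → ℕ) (X : Finset V) (h4 : #X = 4)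
    (ht : ∀ x y z, x ∈ X → y ∈ X → z ∈ X → x ≠ y → x ≠ z → y ≠ z →
      w {x, y} + w {x, z} + w {y, z} ≤ 12) : SS 2 w X ≤ 24 := by
  obtain ⟨p, Y, hp, rfl, hY⟩ := card_eq_succ.1 h4
  obtain ⟨q, r, s, hqr, hqs, hrs, rfl⟩ := card_eq_three.1 hY
  have hp' := hp
  simp only [mem_insert, mem_singleton, not_or] at hp'
  obtain ⟨pq, pr, ps⟩ := hp'
  have hq : q ∉ ({r, s} : Finset V) := by simp [hqr, hqs]
  have hr : r ∉ ({s} : Finset V) := by simp [hrs]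
  have e : SS 2 w {s} = 0 := by
    unfold SS
    rw [powersetCard_eq_empty.2 (by simp)]; simp
  rw [SS2_insert w hp, SS2_insert w hq, SS2_insert w hr, e, sum_insert hq, sum_insert hr,
    sum_insert hr]
  simp only [sum_singleton]
  have t1 := ht p q r (by simp) (by simp) (by simp) pq pr hqr
  have t2 := ht p q s (by simp) (by simp) (by simp) pq ps hqs
  have t3 := ht p r s (by simp) (by simp) (by simp) pr ps hrs
  have t4 := ht q r s (by simp) (by simp) (by simp) hqr hqs hrs
  omega

lemma nine {G : Finset (Finset V)} (hG : F33Free G) {W X : Finset V} (hd : Disjoint W X)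
    (hW : Complete G W) (h5 : #W = 5) (h4 : #X = 4) : SS 3 (ind G) (W ∪ X) ≤ 70 := by
  rw [SS3_union _ _ _ hd]
  have h1 := SS_le 3 (ind G) W (ind_le G)
  have h2 := SS_le 3 (ind G) X (ind_le G)
  rw [h5, show Nat.choose 5 3 = 10 by decide] at h1
  rw [h4, show Nat.choose 4 3 = 4 by decide] at h2
  have hnot : ∀ x ∈ X, x ∉ W := fun x hx hs => disjoint_left.1 hd hs hx
  have h3 : ∑ x ∈ X, SS 2 (fun p => ind G (insert x p)) W ≤ ∑ x ∈ X, 8 :=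
    sum_le_sum (fun x hx => five hG hW h5 (hnot x hx))
  rw [sum_const, h4, smul_eq_mul] at h3
  have h6 := four24 (fun p => ∑ s ∈ W, ind G (insert s p)) X h4
    (by
      intro x y z hx hy hz hxy hxz hyz
      have := tri hG hW (hnot x hx) (hnot y hy) (hnot z hz) hxy hxz hyz
      rw [h5] at this
      exact this)
  omega

/-- no complete 4-set: density at most 3/4 -/
lemma noK4 {G : Finset (Finset V)} (n : ℕ) (hn : 4 ≤ n) : ∀ U : Finset V, #U = n →
    (∀ S, S ⊆ U → #S = 4 → ¬ Complete G S) → 4 * SS 3 (ind G) U ≤ 3 * n.choose 3 := by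
  induction n, hn using Nat.le_induction with
  | base =>
    intro U hU h
    by_contra hc
    apply h U (Subset.refl _) hU
    apply complete_of
    rw [hU]
    rw [show Nat.choose 4 3 = 4 by decide] at *
    omega
  | succ n hn ih =>
    intro U hU h
    have h1 := SS_avg 3 (ind G) U
    have h2 : ∑ v ∈ U, 4 * SS 3 (ind G) (U.erase v) ≤ ∑ v ∈ U, 3 * n.choose 3 := by
      apply sum_le_sum
      intro v hv
      apply ih
      · rw [card_erase_of_mem hv, hU]; rfl
      · intro S hS
        exact h S (hS.trans (erase_subset _ _))
    rw [← mul_sum, sum_const, hU, smul_eq_mul] at h2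
    rw [hU] at h1
    have h3 : (n + 1) * n.choose 3 + 3 * (n+1).choose 3 = (n + 1) * (n+1).choose 3 := by
      have a := c3 n
      have b := c3 (n+1)
      nlinarith
    obtain ⟨k, rfl⟩ : ∃ k, n = k + 4 := ⟨n - 4, by omega⟩
    have h4 : (k + 2) * (4 * SS 3 (ind G) U) ≤ (k + 2) * (3 * (k + 4 + 1).choose 3) := by
      nlinarith
    exact Nat.le_of_mul_le_mul_left h4 (by omega)

theorem upper {G : Finset (Finset V)} (hG : F33Free G) (n : ℕ) : ∀ U : Finset V, #U = n →
    SS 3 (ind G) U ≤ if n = 5 then 10 else b n := by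
  induction n using Nat.strong_induction_on with
  | _ n ih =>
  intro U hU
  have htriv := SS_le 3 (ind G) U (ind_le G)
  rw [hU] at htriv
  by_cases h5 : n ≤ 5
  · interval_cases n <;> exact htriv
  push Not at h5
  rw [if_neg (by omega)]
  by_cases hK5 : ∃ W, W ⊆ U ∧ #W = 5 ∧ Complete G W
  · obtain ⟨W, hWU, hW5, hW⟩ := hK5
    set X := U \ W with hX
    have hd : Disjoint W X := disjoint_sdiff
    have hUX : W ∪ X = U := union_sdiff_of_subset hWU
    have hXc : #X = n - 5 := by rw [hX, card_sdiff_of_subset hWU, hU, hW5]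
    by_cases h9 : n = 9
    · have := nine hG hd hW hW5 (by omega)
      rw [hUX] at this
      rw [h9]
      exact this
    · have hnot : ∀ x ∈ X, x ∉ W := fun x hx hs => disjoint_left.1 hd hs hx
      obtain ⟨v, hv, hvs⟩ : ∃ v ∈ W,
          ∑ x ∈ X, SS 2 (fun p => ind G (insert x p)) (W.erase v) < 5 * #X := by
        by_contra hc
        push Not at hc
        have h1 : ∑ v ∈ W, 5 * #X ≤
            ∑ v ∈ W, ∑ x ∈ X, SS 2 (fun p => ind G (insert x p)) (W.erase v) := sum_le_sum hc
        rw [sum_comm, sum_const, hW5, smul_eq_mul] at h1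
        have h2 : ∑ x ∈ X, ∑ v ∈ W, SS 2 (fun p => ind G (insert x p)) (W.erase v) ≤
            ∑ x ∈ X, 24 := by
          apply sum_le_sum
          intro x hx
          have h3 := SS_avg 2 (fun p => ind G (insert x p)) W
          have h4 := five hG hW hW5 (hnot x hx)
          rw [hW5] at h3
          omega
        rw [sum_const, smul_eq_mul] at h2
        omega
      have hvX : v ∉ X := fun h => hnot v h hv
      have hdis : Disjoint (W.erase v) (insert v X) := by
        rw [disjoint_insert_right]
        exact ⟨notMem_erase _ _, hd.mono_left (erase_subset _ _)⟩
      have hun : W.erase v ∪ insert v X = U := by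
        rw [← hUX]
        ext t
        simp only [mem_union, mem_erase, mem_insert]
        by_cases htv : t = v
        · subst htv; simp [hv]
        · simp [htv]
      have hc4 : #(W.erase v) = 4 := by rw [card_erase_of_mem hv, hW5]
      have hcX : #(insert v X) = n - 4 := by rw [card_insert_of_notMem hvX, hXc]; omega
      have := step4 hG hdis (fun e he => hW e (he.trans (erase_subset _ _))) hc4
        (by
          rw [sum_insert hvX, card_insert_of_notMem hvX]
          have := SS_le 2 (fun p => ind G (insert v p)) (W.erase v) (fun e => ind_le G _)
          rw [hc4, show Nat.choose 4 2 = 6 by decide] at this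
          omega)
        (by
          have := ih (n - 4) (by omega) _ hcX
          rw [if_neg (by omega)] at this
          rwa [hcX])
      rw [hun, hU] at this
      exact this
  · by_cases hK4 : ∃ S, S ⊆ U ∧ #S = 4 ∧ Complete G S
    · obtain ⟨S, hSU, hS4, hS⟩ := hK4
      set X := U \ S with hX
      have hd : Disjoint S X := disjoint_sdiff
      have hUX : S ∪ X = U := union_sdiff_of_subset hSU
      have hXU : X ⊆ U := sdiff_subset
      have hXc : #X = n - 4 := by rw [hX, card_sdiff_of_subset hSU, hU, hS4]
      have hnot : ∀ x ∈ X, x ∉ S := fun x hx hs => disjoint_left.1 hd hs hx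
      have := step4 hG hd hS hS4
        (by
          rw [mul_comm, ← smul_eq_mul, ← sum_const]
          apply sum_le_sum
          intro x hx
          by_contra hc
          apply hK5
          refine ⟨insert x S, insert_subset (hXU hx) hSU, ?_, ?_⟩
          · rw [card_insert_of_notMem (hnot x hx), hS4]
          · exact complete_insert (hnot x hx) hS hS4 (by omega))
        (by
          have := ih (n - 4) (by omega) X hXc
          rw [hXc]
          by_cases h9 : n - 4 = 5
          · rw [h9] at hXc ⊢
            by_contra hc
            apply hK5
            refine ⟨X, hXU, hXc, complete_of ?_⟩
            rw [hXc]
            have e1 : b 5 = 9 := by decide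
            have e2 : Nat.choose 5 3 = 10 := by decide
            omega
          · rwa [if_neg h9] at this)
      rw [hUX, hU] at this
      exact this
    · push Not at hK4
      have h1 := noK4 (G := G) n (by omega) U hU hK4
      have h2 := b_dens n
      omega

lemma prop33 {a b c x y z : Prop}
    (k0 : ¬ (a ∧ b ∧ c) ∧ ¬ (¬ a ∧ ¬ b ∧ ¬ c))
    (k1 : ¬ (a ∧ x ∧ y) ∧ ¬ (¬ a ∧ ¬ x ∧ ¬ y))
    (k2 : ¬ (a ∧ x ∧ z) ∧ ¬ (¬ a ∧ ¬ x ∧ ¬ z))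
    (k3 : ¬ (a ∧ y ∧ z) ∧ ¬ (¬ a ∧ ¬ y ∧ ¬ z))
    (k4 : ¬ (b ∧ x ∧ y) ∧ ¬ (¬ b ∧ ¬ x ∧ ¬ y))
    (k5 : ¬ (b ∧ x ∧ z) ∧ ¬ (¬ b ∧ ¬ x ∧ ¬ z))
    (k6 : ¬ (b ∧ y ∧ z) ∧ ¬ (¬ b ∧ ¬ y ∧ ¬ z))
    (k7 : ¬ (c ∧ x ∧ y) ∧ ¬ (¬ c ∧ ¬ x ∧ ¬ y))
    (k8 : ¬ (c ∧ x ∧ z) ∧ ¬ (¬ c ∧ ¬ x ∧ ¬ z))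
    (k9 : ¬ (c ∧ y ∧ z) ∧ ¬ (¬ c ∧ ¬ y ∧ ¬ z)) : False := by
  by_cases ha : a <;> by_cases hb : b <;> by_cases hx : x <;> by_cases hy : y <;> grind

theorem lower (n : ℕ) : ∃ G : Finset (Finset (Fin n)),
      (∀ e ∈ G, e.card = 3) ∧ F33Free G ∧ G.card = b n := by
  set A : Finset (Fin n) := univ.filter (fun i => i.val < n / 2) with hA
  have hAc : #A = n / 2 := by
    rw [hA, Fin.card_filter_val_lt]; omega
  have hBc : #Aᶜ = (n + 1) / 2 := by
    rw [card_compl, hAc, Fintype.card_fin]; omega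
  refine ⟨powersetCard 3 univ \ (powersetCard 3 A ∪ powersetCard 3 Aᶜ), ?_, ?_, ?_⟩
  · intro e he
    exact (mem_powersetCard.1 (mem_sdiff.1 he).1).2
  · have key : ∀ p q r : Fin n,
        ({p, q, r} : Finset (Fin n)) ∈ powersetCard 3 univ \ (powersetCard 3 A ∪ powersetCard 3 Aᶜ) →
        ¬ (p ∈ A ∧ q ∈ A ∧ r ∈ A) ∧ ¬ (p ∉ A ∧ q ∉ A ∧ r ∉ A) := by
      intro p q r h
      simp only [mem_sdiff, mem_union, mem_powersetCard, not_or, insert_subset_iff,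
        singleton_subset_iff, mem_compl] at h
      tauto
    rintro ⟨a, b, c, x, y, z, _, h0, h1, h2, h3, h4, h5, h6, h7, h8, h9⟩
    have k0 := key _ _ _ h0
    have k1 := key _ _ _ h1
    have k2 := key _ _ _ h2
    have k3 := key _ _ _ h3
    have k4 := key _ _ _ h4
    have k5 := key _ _ _ h5
    have k6 := key _ _ _ h6
    have k7 := key _ _ _ h7
    have k8 := key _ _ _ h8
    have k9 := key _ _ _ h9
    clear h0 h1 h2 h3 h4 h5 h6 h7 h8 h9 key
    exact prop33 k0 k1 k2 k3 k4 k5 k6 k7 k8 k9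
  · rw [card_sdiff_of_subset, card_union_of_disjoint, card_powersetCard, card_powersetCard,
      card_powersetCard, hAc, hBc, card_univ, Fintype.card_fin]
    · unfold b; omega
    · rw [disjoint_left]
      intro e h1 h2
      rw [mem_powersetCard] at h1 h2
      obtain ⟨x, hx⟩ : e.Nonempty := card_pos.1 (by omega)
      exact (mem_compl.1 (h2.1 hx)) (h1.1 hx)
    · apply union_subset <;> exact powersetCard_mono (subset_univ _)

lemma card_eq {n : ℕ} {G : Finset (Finset (Fin n))} (h : ∀ e ∈ G, e.card = 3) :
    SS 3 (ind G) univ = #G := by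
  unfold SS ind
  rw [← sum_filter, ← card_eq_sum_ones]
  congr 1
  ext e
  simp only [mem_filter, mem_powersetCard, subset_univ, true_and]
  exact ⟨fun h => h.2, fun he => ⟨h e he, he⟩⟩

end F33proof

theorem ex_F33 (n : ℕ) (hn : 1 ≤ n) :
    IsGreatest {k : ℕ | ∃ G : Finset (Finset (Fin n)),
      (∀ e ∈ G, e.card = 3) ∧ F33Free G ∧ G.card = k}
      (if n = 5 then 10 else b n) := by
  constructor
  · split_ifs with h
    · subst h
      refine ⟨Finset.powersetCard 3 Finset.univ, ?_, ?_, ?_⟩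
      · intro e he
        exact (Finset.mem_powersetCard.1 he).2
      · rintro ⟨a, b, c, x, y, z, h6, _⟩
        have := Finset.card_le_univ ({a, b, c, x, y, z} : Finset (Fin 5))
        rw [h6] at this
        simp at this
      · rw [Finset.card_powersetCard]; rfl
    · exact F33proof.lower n
  · rintro k ⟨G, h3, hfree, rfl⟩
    rw [← F33proof.card_eq h3]
    exact F33proof.upper hfree n Finset.univ (by simp)
end

section
/- For every integer n ≥ 1 with n ≠ 5, every F_{3,3}-free 3-graph on n vertices has at most b(n) edges. -/
open Finset

section F33aux
variable {V : Type*} [DecidableEq V]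

/-- Boolean indicator of an edge. -/
def tE (G : Finset (Finset V)) (x y z : V) : Bool := decide (({x, y, z} : Finset V) ∈ G)

/-- number of edges inside `W`. -/
def eIn (G : Finset (Finset V)) (W : Finset V) : ℕ := #{t ∈ G | t ⊆ W}

/-- number of edges containing `v` and otherwise inside `U`. -/
def dIn (G : Finset (Finset V)) (v : V) (U : Finset V) : ℕ := #{t ∈ G | v ∈ t ∧ t ⊆ insert v U}

theorem tE_swap12 (G : Finset (Finset V)) (x y z : V) : tE G x y z = tE G y x z := by
  unfold tE; rw [Finset.insert_comm]

theorem tE_swap23 (G : Finset (Finset V)) (x y z : V) : tE G x y z = tE G x z y := by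
  unfold tE; rw [Finset.pair_comm]

theorem eIn_insert (G : Finset (Finset V)) (v : V) (U : Finset V) (hv : v ∉ U) :
    eIn G (insert v U) = eIn G U + dIn G v U := by
  unfold eIn dIn
  rw [← card_union_of_disjoint]
  · congr 1
    ext t
    simp only [mem_filter, mem_union]
    constructor
    · rintro ⟨h1, h2⟩
      by_cases hvt : v ∈ t
      · exact Or.inr ⟨h1, hvt, h2⟩
      · exact Or.inl ⟨h1, (subset_insert_iff_of_notMem hvt).1 h2⟩
    · rintro (⟨h1, h2⟩ | ⟨h1, _, h2⟩)
      · exact ⟨h1, h2.trans (subset_insert _ _)⟩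
      · exact ⟨h1, h2⟩
  · rw [disjoint_left]
    intro t h1 h2
    simp only [mem_filter] at h1 h2
    exact hv (h1.2 h2.2.1)

theorem dIn_empty (G : Finset (Finset V)) (h3 : ∀ e ∈ G, e.card = 3) (v : V) :
    dIn G v ∅ = 0 := by
  unfold dIn
  rw [card_eq_zero, filter_eq_empty_iff]
  rintro t ht ⟨_, h⟩
  have := card_le_card h
  rw [h3 t ht] at this
  simp at this

theorem codeg (G : Finset (Finset V)) (h3 : ∀ e ∈ G, e.card = 3) (v u : V) (U : Finset V)
    (hvu : v ≠ u) (hv : v ∉ U) (hu : u ∉ U) :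
    #{t ∈ G | v ∈ t ∧ u ∈ t ∧ t ⊆ insert v (insert u U)} = ∑ x ∈ U, (tE G v u x).toNat := by
  have h1 : ∑ x ∈ U, (tE G v u x).toNat = #{x ∈ U | ({v, u, x} : Finset V) ∈ G} := by
    rw [card_filter]
    apply sum_congr rfl
    intro x _
    unfold tE
    by_cases h : ({v, u, x} : Finset V) ∈ G <;> simp [h]
  rw [h1]
  have h2 : ({t ∈ G | v ∈ t ∧ u ∈ t ∧ t ⊆ insert v (insert u U)} : Finset (Finset V)) =
      ({x ∈ U | ({v, u, x} : Finset V) ∈ G}).image (fun x => ({v, u, x} : Finset V)) := by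
    ext t
    simp only [mem_filter, mem_image]
    constructor
    · rintro ⟨ht, hvt, hut, hs⟩
      have hc : #((t.erase v).erase u) = 1 := by
        rw [card_erase_of_mem (mem_erase.2 ⟨hvu.symm, hut⟩), card_erase_of_mem hvt, h3 t ht]
      obtain ⟨x, hx⟩ := card_eq_one.1 hc
      have hxm : x ∈ (t.erase v).erase u := by rw [hx]; simp
      simp only [mem_erase] at hxm
      have hxU : x ∈ U := by
        have := hs hxm.2.2
        simp only [mem_insert] at this
        tauto
      have hte : ({v, u, x} : Finset V) = t := by
        rw [← insert_erase hvt, ← insert_erase (mem_erase.2 ⟨hvu.symm, hut⟩), hx]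
      exact ⟨x, ⟨hxU, by rw [hte]; exact ht⟩, hte⟩
    · rintro ⟨x, ⟨hxU, hG⟩, rfl⟩
      refine ⟨hG, by simp, by simp, ?_⟩
      intro y hy
      simp only [mem_insert, mem_singleton] at hy ⊢
      rcases hy with h | h | h
      · tauto
      · tauto
      · subst h; tauto
  rw [h2, card_image_of_injOn]
  intro x hx y hy hxy
  simp only [coe_filter, Set.mem_ofPred_eq] at hx hy
  have : x ∈ ({v, u, y} : Finset V) := by
    have h : x ∈ ({v, u, x} : Finset V) := by simp
    simp only at hxy
    rw [hxy] at h; exact h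
  simp only [mem_insert, mem_singleton] at this
  rcases this with h | h | h
  · subst h; exact absurd hx.1 hv
  · subst h; exact absurd hx.1 hu
  · exact h

theorem dIn_insert (G : Finset (Finset V)) (h3 : ∀ e ∈ G, e.card = 3) (v u : V) (U : Finset V)
    (hvu : v ≠ u) (hv : v ∉ U) (hu : u ∉ U) :
    dIn G v (insert u U) = dIn G v U + ∑ x ∈ U, (tE G v u x).toNat := by
  rw [← codeg G h3 v u U hvu hv hu]
  unfold dIn
  rw [← card_union_of_disjoint]
  · congr 1
    ext t
    simp only [mem_filter, mem_union]
    constructor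
    · rintro ⟨h1, h2, h4⟩
      by_cases hut : u ∈ t
      · exact Or.inr ⟨h1, h2, hut, h4⟩
      · rw [insert_comm] at h4
        exact Or.inl ⟨h1, h2, (subset_insert_iff_of_notMem hut).1 h4⟩
    · rintro (⟨h1, h2, h4⟩ | ⟨h1, h2, _, h4⟩)
      · exact ⟨h1, h2, h4.trans (insert_subset_insert _ (subset_insert _ _))⟩
      · exact ⟨h1, h2, h4⟩
  · rw [disjoint_left]
    intro t h1 h2
    simp only [mem_filter] at h1 h2
    have := h1.2.2 h2.2.2.1
    simp only [mem_insert] at this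
    rcases this with h | h
    · exact hvu h.symm
    · exact hu h

/-- number of edges with two vertices in `{a,b,c,d}` and third vertex `x`. -/
def hP (G : Finset (Finset V)) (a b c d x : V) : ℕ :=
  (tE G a b x).toNat + (tE G a c x).toNat + (tE G a d x).toNat + (tE G b c x).toNat +
  (tE G b d x).toNat + (tE G c d x).toNat

/-- multiplicity of the pair `xy` in the link multigraph. -/
def wP (G : Finset (Finset V)) (a b c d x y : V) : ℕ :=
  (tE G a x y).toNat + (tE G b x y).toNat + (tE G c x y).toNat + (tE G d x y).toNat

/-- size of the link multigraph. -/
def lP (G : Finset (Finset V)) (a b c d : V) (U : Finset V) : ℕ :=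
  dIn G a U + dIn G b U + dIn G c U + dIn G d U

theorem expand4 (G : Finset (Finset V)) (h3 : ∀ e ∈ G, e.card = 3) (a b c d : V) (U : Finset V)
    (hab : a ≠ b) (hac : a ≠ c) (had : a ≠ d) (hbc : b ≠ c) (hbd : b ≠ d) (hcd : c ≠ d)
    (ha : a ∉ U) (hb : b ∉ U) (hc : c ∉ U) (hd : d ∉ U) :
    eIn G (insert a (insert b (insert c (insert d U)))) = eIn G U + lP G a b c d U
      + ∑ x ∈ U, hP G a b c d x + ((tE G a b c).toNat + (tE G a b d).toNat +
        (tE G a c d).toNat + (tE G b c d).toNat) := by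
  rw [eIn_insert _ a _ (by simp [*]), eIn_insert _ b _ (by simp [*]),
    eIn_insert _ c _ (by simp [*]), eIn_insert _ d _ (by simp [*])]
  rw [dIn_insert G h3 a b _ hab (by simp [*]) (by simp [*]),
    dIn_insert G h3 a c _ hac (by simp [*]) (by simp [*]),
    dIn_insert G h3 a d _ had (by simp [*]) (by simp [*]),
    dIn_insert G h3 b c _ hbc (by simp [*]) (by simp [*]),
    dIn_insert G h3 b d _ hbd (by simp [*]) (by simp [*]),
    dIn_insert G h3 c d _ hcd (by simp [*]) (by simp [*])]
  rw [sum_insert (by simp [*]), sum_insert (by simp [*]), sum_insert (by simp [*]),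
    sum_insert (by simp [*])]
  unfold lP hP
  simp only [sum_add_distrib]
  ring

theorem lP_insert (G : Finset (Finset V)) (h3 : ∀ e ∈ G, e.card = 3) (a b c d u : V) (U : Finset V)
    (ha : a ∉ insert u U) (hb : b ∉ insert u U) (hc : c ∉ insert u U) (hd : d ∉ insert u U)
    (hu : u ∉ U) :
    lP G a b c d (insert u U) = lP G a b c d U + ∑ x ∈ U, wP G a b c d u x := by
  simp only [mem_insert, not_or] at ha hb hc hd
  unfold lP wP
  rw [dIn_insert G h3 a u U ha.1 ha.2 hu, dIn_insert G h3 b u U hb.1 hb.2 hu,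
    dIn_insert G h3 c u U hc.1 hc.2 hu, dIn_insert G h3 d u U hd.1 hd.2 hu]
  simp only [sum_add_distrib]
  ring

theorem lP_le_three (G : Finset (Finset V)) (h3 : ∀ e ∈ G, e.card = 3) (a b c d : V) (U : Finset V)
    (ha : a ∉ U) (hb : b ∉ U) (hc : c ∉ U) (hd : d ∉ U)
    (h : ∀ x ∈ U, ∀ y ∈ U, x ≠ y → wP G a b c d x y ≤ 3) :
    lP G a b c d U ≤ 3 * (#U).choose 2 := by
  induction U using Finset.induction_on with
  | empty => simp [lP, dIn_empty G h3]
  | insert u U hu ih =>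
    rw [lP_insert G h3 a b c d u U ha hb hc hd hu, card_insert_of_notMem hu]
    simp only [mem_insert, not_or] at ha hb hc hd
    have h1 := ih ha.2 hb.2 hc.2 hd.2
      (fun x hx y hy => h x (mem_insert_of_mem hx) y (mem_insert_of_mem hy))
    have h2 : ∑ x ∈ U, wP G a b c d u x ≤ ∑ x ∈ U, 3 :=
      sum_le_sum (fun x hx => h u (mem_insert_self _ _) x (mem_insert_of_mem hx)
        (by rintro rfl; exact hu hx))
    rw [sum_const, smul_eq_mul] at h2
    have h4 : (#U + 1).choose 2 = #U + (#U).choose 2 := by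
      rw [Nat.choose_succ_succ' (#U) 1, Nat.choose_one_right]
    omega

theorem free_bool (G : Finset (Finset V)) (hfree : F33Free G) (a b c x y z : V)
    (h6 : ({a, b, c, x, y, z} : Finset V).card = 6) :
    (tE G a b c && tE G a x y && tE G a x z && tE G a y z && tE G b x y && tE G b x z
      && tE G b y z && tE G c x y && tE G c x z && tE G c y z) = false := by
  rw [Bool.eq_false_iff]
  intro h
  simp only [Bool.and_eq_true, tE, decide_eq_true_eq] at h
  apply hfree
  exact ⟨a, b, c, x, y, z, h6, by tauto⟩

theorem tri_aux (G : Finset (Finset V)) (hfree : F33Free G) (a b c x y z : V)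
    (h6 : ({a, b, c, x, y, z} : Finset V).card = 6) (habc : tE G a b c = true)
    (h1 : tE G a x y = true) (h2 : tE G b x y = true) (h4 : tE G c x y = true) :
    (tE G a x z).toNat + (tE G b x z).toNat + (tE G c x z).toNat +
    ((tE G a y z).toNat + (tE G b y z).toNat + (tE G c y z).toNat) ≤ 5 := by
  have := free_bool G hfree a b c x y z h6
  rw [habc, h1, h2, h4] at this
  revert this
  generalize tE G a x z = p1
  generalize tE G b x z = p2
  generalize tE G c x z = p3
  generalize tE G a y z = p4
  generalize tE G b y z = p5
  generalize tE G c y z = p6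
  revert p1 p2 p3 p4 p5 p6
  decide

theorem card6 (a b c x y z : V) (h : [a, b, c, x, y, z].Nodup) :
    ({a, b, c, x, y, z} : Finset V).card = 6 := by
  have := List.toFinset_card_of_nodup h
  simpa using this

theorem tri_le (G : Finset (Finset V)) (hfree : F33Free G) (a b c d x y z : V)
    (hn : [a, b, c, d, x, y, z].Nodup)
    (habc : tE G a b c = true) (habd : tE G a b d = true) (hacd : tE G a c d = true)
    (hbcd : tE G b c d = true) (hxy : wP G a b c d x y = 4) :
    wP G a b c d x z + wP G a b c d y z ≤ 6 := by
  unfold wP at *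
  have b1 := Bool.toNat_le (tE G a x y)
  have b2 := Bool.toNat_le (tE G b x y)
  have b3 := Bool.toNat_le (tE G c x y)
  have b4 := Bool.toNat_le (tE G d x y)
  have e1 : tE G a x y = true := by rw [← Bool.toNat_eq_one]; omega
  have e2 : tE G b x y = true := by rw [← Bool.toNat_eq_one]; omega
  have e3 : tE G c x y = true := by rw [← Bool.toNat_eq_one]; omega
  have e4 : tE G d x y = true := by rw [← Bool.toNat_eq_one]; omega
  have t1 := tri_aux G hfree a b c x y z
    (card6 _ _ _ _ _ _ (by simp at hn ⊢; tauto)) habc e1 e2 e3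
  have t2 := tri_aux G hfree a b d x y z
    (card6 _ _ _ _ _ _ (by simp at hn ⊢; tauto)) habd e1 e2 e4
  have t3 := tri_aux G hfree a c d x y z
    (card6 _ _ _ _ _ _ (by simp at hn ⊢; tauto)) hacd e1 e3 e4
  have t4 := tri_aux G hfree b c d x y z
    (card6 _ _ _ _ _ _ (by simp at hn ⊢; tauto)) hbcd e2 e3 e4
  omega

theorem wP_le (G : Finset (Finset V)) (a b c d x y : V) : wP G a b c d x y ≤ 4 := by
  unfold wP
  have b1 := Bool.toNat_le (tE G a x y)
  have b2 := Bool.toNat_le (tE G b x y)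
  have b3 := Bool.toNat_le (tE G c x y)
  have b4 := Bool.toNat_le (tE G d x y)
  omega

theorem lP_le (G : Finset (Finset V)) (h3 : ∀ e ∈ G, e.card = 3) (hfree : F33Free G)
    (a b c d : V) (hn : [a, b, c, d].Nodup)
    (habc : tE G a b c = true) (habd : tE G a b d = true) (hacd : tE G a c d = true)
    (hbcd : tE G b c d = true) (m : ℕ) : ∀ (U : Finset V), #U = m →
    a ∉ U → b ∉ U → c ∉ U → d ∉ U →
    lP G a b c d U ≤ 3 * m.choose 2 + m / 2 := by
  induction m using Nat.strong_induction_on with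
  | _ m ih =>
  intro U hU ha hb hc hd
  by_cases h : ∀ x ∈ U, ∀ y ∈ U, x ≠ y → wP G a b c d x y ≤ 3
  · have := lP_le_three G h3 a b c d U ha hb hc hd h
    rw [hU] at this
    omega
  · push Not at h
    obtain ⟨x, hx, y, hy, hxy, hw⟩ := h
    have hw4 : wP G a b c d x y = 4 := by
      have := wP_le G a b c d x y
      omega
    set U' := (U.erase x).erase y with hU'
    have hyx : y ∈ U.erase x := mem_erase.2 ⟨hxy.symm, hy⟩
    have e1 : insert x (insert y U') = U := by
      rw [hU', insert_erase hyx, insert_erase hx]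
    have hyU' : y ∉ U' := by simp [hU']
    have hxU' : x ∉ insert y U' := by simp [hU', hxy]
    have hsub : U' ⊆ U := (erase_subset _ _).trans (erase_subset _ _)
    have hc' : #U = #U' + 2 := by
      rw [← e1, card_insert_of_notMem hxU', card_insert_of_notMem hyU']
    have hins : insert y U' ⊆ U := by rw [← e1]; exact subset_insert _ _
    have q1 := lP_insert G h3 a b c d x (insert y U') (by rw [e1]; exact ha)
      (by rw [e1]; exact hb) (by rw [e1]; exact hc) (by rw [e1]; exact hd) hxU'
    have q2 := lP_insert G h3 a b c d y U' (fun h => ha (hins h))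
      (fun h => hb (hins h)) (fun h => hc (hins h)) (fun h => hd (hins h)) hyU'
    rw [e1, sum_insert hyU', q2, hw4] at q1
    have q3 : ∑ z ∈ U', wP G a b c d x z + ∑ z ∈ U', wP G a b c d y z ≤ ∑ z ∈ U', 6 := by
      rw [← sum_add_distrib]
      apply sum_le_sum
      intro z hz
      apply tri_le G hfree a b c d x y z _ habc habd hacd hbcd hw4
      have hzU := hsub hz
      have n1 : ∀ v, v ∉ U → v ≠ x ∧ v ≠ y ∧ v ≠ z := fun v hv =>
        ⟨fun h => hv (h ▸ hx), fun h => hv (h ▸ hy), fun h => hv (h ▸ hzU)⟩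
      have n2 := n1 a ha
      have n3 := n1 b hb
      have n4 := n1 c hc
      have n5 := n1 d hd
      have n6 : y ≠ z := fun h => hyU' (h ▸ hz)
      have n7 : x ≠ z := fun h => hxU' (h ▸ mem_insert_of_mem hz)
      simp at hn ⊢
      tauto
    rw [sum_const, smul_eq_mul] at q3
    have q4 := ih (#U') (by omega) U' rfl (fun h => ha (hsub h)) (fun h => hb (hsub h))
      (fun h => hc (hsub h)) (fun h => hd (hsub h))
    have hm : m = #U' + 2 := by omega
    have q5 : (#U' + 2).choose 2 = 2 * #U' + 1 + (#U').choose 2 := by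
      rw [Nat.choose_succ_succ' (#U' + 1) 1, Nat.choose_succ_succ' (#U') 1, Nat.choose_one_right,
        Nat.choose_one_right]
      ring
    rw [hm, q5]
    omega

theorem eIn_lt (G : Finset (Finset V)) (h3 : ∀ e ∈ G, e.card = 3) (W : Finset V)
    (h : ¬ W.powersetCard 3 ⊆ G) : eIn G W < (#W).choose 3 := by
  rw [← card_powersetCard]
  apply card_lt_card
  rw [ssubset_iff_subset_ne]
  constructor
  · intro t ht
    rw [mem_filter] at ht
    exact mem_powersetCard.2 ⟨ht.2, h3 t ht.1⟩
  · intro he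
    apply h
    rw [← he]
    exact filter_subset _ _

theorem eIn_le (G : Finset (Finset V)) (h3 : ∀ e ∈ G, e.card = 3) (W : Finset V) :
    eIn G W ≤ (#W).choose 3 := by
  rw [← card_powersetCard]
  apply card_le_card
  intro t ht
  rw [mem_filter] at ht
  exact mem_powersetCard.2 ⟨ht.2, h3 t ht.1⟩

theorem eIn_sum (G : Finset (Finset V)) (h3 : ∀ e ∈ G, e.card = 3) (W : Finset V) :
    ∑ v ∈ W, eIn G (W.erase v) = (#W - 3) * eIn G W := by
  have h1 : ∀ v, eIn G (W.erase v) = ∑ t ∈ G with t ⊆ W, if v ∉ t then 1 else 0 := by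
    intro v
    unfold eIn
    rw [← card_filter, filter_filter]
    congr 1
    ext t
    simp only [mem_filter, subset_erase]
  simp_rw [h1]
  rw [sum_comm]
  have h2 : ∀ t ∈ ({t ∈ G | t ⊆ W} : Finset (Finset V)),
      (∑ v ∈ W, if v ∉ t then 1 else 0) = #W - 3 := by
    intro t ht
    rw [mem_filter] at ht
    rw [← card_filter, ← sdiff_eq_filter, card_sdiff_of_subset ht.2, h3 t ht.1]
  rw [sum_congr rfl h2, sum_const, smul_eq_mul, mul_comm]
  rfl

theorem k4free (G : Finset (Finset V)) (h3 : ∀ e ∈ G, e.card = 3) (m : ℕ) :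
    ∀ W : Finset V, #W = m + 4 → (∀ S ⊆ W, #S = 4 → ¬ S.powersetCard 3 ⊆ G) →
      4 * eIn G W ≤ 3 * (m + 4).choose 3 := by
  induction m with
  | zero =>
    intro W hW h
    have := eIn_lt G h3 W (h W (Subset.refl _) hW)
    rw [hW] at this
    have h4 : (0 + 4).choose 3 = 4 := by decide
    omega
  | succ m ih =>
    intro W hW h
    have h1 := eIn_sum G h3 W
    have h2 : ∑ v ∈ W, 4 * eIn G (W.erase v) ≤ ∑ v ∈ W, 3 * (m + 4).choose 3 := by
      apply sum_le_sum
      intro v hv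
      apply ih
      · rw [card_erase_of_mem hv, hW]; omega
      · intro S hS
        exact h S (hS.trans (erase_subset _ _))
    rw [← mul_sum, h1, sum_const, smul_eq_mul, hW] at h2
    have h5 : (m + 1 + 4).choose 3 * (m + 2) = (m + 5) * (m + 4).choose 3 := by
      have := Nat.choose_mul_succ_eq (m + 4) 3
      have e : m + 4 + 1 - 3 = m + 2 := by omega
      rw [e] at this
      rw [show m + 1 + 4 = m + 4 + 1 by ring]
      linarith
    have e : m + 1 + 4 - 3 = m + 2 := by omega
    rw [e] at h2
    have : (m + 2) * (4 * eIn G W) ≤ (m + 2) * (3 * (m + 1 + 4).choose 3) := by nlinarith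
    exact Nat.le_of_mul_le_mul_left this (by omega)

theorem ch3 (n : ℕ) : (6 * n.choose 3 : ℤ) = n * (n - 1) * (n - 2) := by
  induction n with
  | zero => simp
  | succ n ih =>
    have h2 : ∀ n : ℕ, (2 * n.choose 2 : ℤ) = n * (n - 1) := by
      intro n
      induction n with
      | zero => simp
      | succ n ih =>
        rw [Nat.choose_succ_succ' n 1, Nat.choose_one_right]
        push_cast
        linarith
    have := h2 n
    rw [Nat.choose_succ_succ' n 2]
    push_cast
    linarith

theorem ch2 (n : ℕ) : (2 * n.choose 2 : ℤ) = n * (n - 1) := by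
  induction n with
  | zero => simp
  | succ n ih =>
    rw [Nat.choose_succ_succ' n 1, Nat.choose_one_right]
    push_cast
    linarith

theorem b_even (k : ℕ) : (b (2 * k) : ℤ) = k * k * (k - 1) := by
  unfold b
  rw [show 2 * k / 2 = k by omega, show (2 * k + 1) / 2 = k by omega]
  have h1 := ch3 (2 * k)
  have h2 := ch3 k
  push_cast at h1
  have h4 : (0 : ℤ) ≤ k * k * (k - 1) := by
    rcases Nat.eq_zero_or_pos k with h | h
    · simp [h]
    · have : (1 : ℤ) ≤ k := by exact_mod_cast h
      have : (0 : ℤ) ≤ k - 1 := by linarith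
      positivity
  have h5 : ((2 * k).choose 3 : ℤ) - k.choose 3 - k.choose 3 = k * k * (k - 1) := by linarith
  omega

theorem b_odd (k : ℕ) : (2 * b (2 * k + 1) : ℤ) = k * (k + 1) * (2 * k - 1) := by
  unfold b
  rw [show (2 * k + 1) / 2 = k by omega, show (2 * k + 1 + 1) / 2 = k + 1 by omega]
  have h1 := ch3 (2 * k + 1)
  have h2 := ch3 k
  have h3 := ch3 (k + 1)
  push_cast at h1 h3
  have h4 : (0 : ℤ) ≤ k * (k + 1) * (2 * k - 1) := by
    rcases Nat.eq_zero_or_pos k with h | h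
    · simp [h]
    · have : (1 : ℤ) ≤ k := by exact_mod_cast h
      have : (0 : ℤ) ≤ 2 * k - 1 := by linarith
      positivity
  have h5 : 2 * (((2 * k + 1).choose 3 : ℤ) - k.choose 3 - (k + 1).choose 3)
    = k * (k + 1) * (2 * k - 1) := by linarith
  omega

theorem b_rec (n : ℕ) : b (n + 4) = b n + (3 * n.choose 2 + n / 2) + 5 * n + 4 := by
  have hc := ch2 n
  obtain ⟨k, hk | hk⟩ := Nat.even_or_odd' n
  · have e1 := b_even k
    have e2 := b_even (k + 2)
    rw [show 2 * (k + 2) = n + 4 by omega] at e2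
    rw [← hk] at e1
    have hd : n / 2 = k := by omega
    rw [hd]
    have hn : (n : ℤ) = 2 * k := by exact_mod_cast hk
    rw [hn] at hc
    push_cast at e2
    zify
    rw [hn]
    linarith
  · have e1 := b_odd k
    have e2 := b_odd (k + 2)
    rw [show 2 * (k + 2) + 1 = n + 4 by omega] at e2
    rw [← hk] at e1
    have hd : n / 2 = k := by omega
    rw [hd]
    have hn : (n : ℤ) = 2 * k + 1 := by exact_mod_cast hk
    rw [hn] at hc
    push_cast at e2
    zify
    rw [hn]
    linarith

theorem b_ge (n : ℕ) (hn : 1 ≤ n) : 3 * n.choose 3 ≤ 4 * b n := by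
  have hc := ch3 n
  obtain ⟨k, hk | hk⟩ := Nat.even_or_odd' n
  · have e1 := b_even k
    rw [← hk] at e1
    have hn : (n : ℤ) = 2 * k := by exact_mod_cast hk
    rw [hn] at hc
    zify
    have : (1 : ℤ) ≤ k := by
      have : 1 ≤ k := by omega
      exact_mod_cast this
    nlinarith [mul_nonneg (by linarith : (0 : ℤ) ≤ k) (by linarith : (0 : ℤ) ≤ k - 1)]
  · have e1 := b_odd k
    rw [← hk] at e1
    have hn : (n : ℤ) = 2 * k + 1 := by exact_mod_cast hk
    rw [hn] at hc
    zify
    rcases Nat.eq_zero_or_pos k with h | h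
    · subst h; simp at hc e1; simp [hc]
    · have : (1 : ℤ) ≤ k := by exact_mod_cast h
      nlinarith [mul_nonneg (by linarith : (0 : ℤ) ≤ k) (by linarith : (0 : ℤ) ≤ 2 * k - 1)]

theorem bool_aux : ∀ p01 p02 p03 p04 p12 p13 p14 p23 p24 p34 : Bool,
    ((p01 && p02 && p12 && p34) ||
     (p01 && p03 && p13 && p24) ||
     (p01 && p04 && p14 && p23) ||
     (p02 && p03 && p23 && p14) ||
     (p02 && p04 && p24 && p13) ||
     (p03 && p04 && p34 && p12) ||
     (p12 && p13 && p23 && p04) ||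
     (p12 && p14 && p24 && p03) ||
     (p13 && p14 && p34 && p02) ||
     (p23 && p24 && p34 && p01) ||
     (p02 && p03 && p04 && p12 && p13 && p14) ||
     (p01 && p03 && p04 && p12 && p23 && p24) ||
     (p01 && p02 && p04 && p13 && p23 && p34) ||
     (p01 && p02 && p03 && p14 && p24 && p34) ||
     (p01 && p13 && p14 && p02 && p23 && p24) ||
     (p01 && p12 && p14 && p03 && p23 && p34) ||
     (p01 && p12 && p13 && p04 && p24 && p34) ||
     (p02 && p12 && p24 && p03 && p13 && p34) ||
     (p02 && p12 && p23 && p04 && p14 && p34) ||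
     (p03 && p13 && p23 && p04 && p14 && p24)) = false →
    p01.toNat + p02.toNat + p03.toNat + p04.toNat + p12.toNat + p13.toNat + p14.toNat +
      p23.toNat + p24.toNat + p34.toNat ≤ 6 := by
  decide +kernel

theorem tE_true (G : Finset (Finset V)) (S : Finset V) (hS : S.powersetCard 3 ⊆ G) (x y z : V)
    (hx : x ∈ S) (hy : y ∈ S) (hz : z ∈ S) (h1 : x ≠ y) (h2 : x ≠ z) (h3 : y ≠ z) :
    tE G x y z = true := by
  unfold tE
  rw [decide_eq_true_eq]
  apply hS
  rw [mem_powersetCard]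
  refine ⟨?_, card_eq_three.2 ⟨x, y, z, h1, h2, h3, rfl⟩⟩
  intro w hw
  simp only [mem_insert, mem_singleton] at hw
  rcases hw with rfl | rfl | rfl <;> assumption

/-- triangle plus disjoint edge in the link of `v` -/
theorem tri_edge (G : Finset (Finset V)) (hfree : F33Free G) (S : Finset V)
    (hS : S.powersetCard 3 ⊆ G) (v x y z s t : V) (hv : v ∉ S)
    (hx : x ∈ S) (hy : y ∈ S) (hz : z ∈ S) (hs : s ∈ S) (ht : t ∈ S)
    (hn : [x, y, z, s, t].Nodup) :
    (tE G x y v && tE G x z v && tE G y z v && tE G s t v) = false := by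
  have n1 : ∀ u ∈ S, v ≠ u := fun u hu h => hv (h ▸ hu)
  have h6 : [v, s, t, x, y, z].Nodup := by
    have := n1 x hx
    have := n1 y hy
    have := n1 z hz
    have := n1 s hs
    have := n1 t ht
    simp at hn ⊢
    grind
  have h := free_bool G hfree v s t x y z (card6 _ _ _ _ _ _ h6)
  simp only [List.nodup_cons, List.mem_cons, not_or] at hn
  rw [tE_true G S hS s x y hs hx hy (by grind) (by grind) (by grind),
    tE_true G S hS s x z hs hx hz (by grind) (by grind) (by grind),
    tE_true G S hS s y z hs hy hz (by grind) (by grind) (by grind),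
    tE_true G S hS t x y ht hx hy (by grind) (by grind) (by grind),
    tE_true G S hS t x z ht hx hz (by grind) (by grind) (by grind),
    tE_true G S hS t y z ht hy hz (by grind) (by grind) (by grind)] at h
  rw [tE_swap12 G v s t, tE_swap23 G s v t, tE_swap12 G v x y, tE_swap23 G x v y,
    tE_swap12 G v x z, tE_swap23 G x v z, tE_swap12 G v y z, tE_swap23 G y v z] at h
  revert h
  cases tE G x y v <;> cases tE G x z v <;> cases tE G y z v <;> cases tE G s t v <;> simp

/-- `K_{2,3}` in the link of `v` -/
theorem k23 (G : Finset (Finset V)) (hfree : F33Free G) (S : Finset V)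
    (hS : S.powersetCard 3 ⊆ G) (v y z p q r : V) (hv : v ∉ S)
    (hy : y ∈ S) (hz : z ∈ S) (hp : p ∈ S) (hq : q ∈ S) (hr : r ∈ S)
    (hn : [y, z, p, q, r].Nodup) :
    (tE G y p v && tE G y q v && tE G y r v && tE G z p v && tE G z q v && tE G z r v)
      = false := by
  have n1 : ∀ u ∈ S, v ≠ u := fun u hu h => hv (h ▸ hu)
  have h6 : [p, q, r, v, y, z].Nodup := by
    have := n1 y hy
    have := n1 z hz
    have := n1 p hp
    have := n1 q hq
    have := n1 r hr
    simp at hn ⊢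
    grind
  have h := free_bool G hfree p q r v y z (card6 _ _ _ _ _ _ h6)
  simp only [List.nodup_cons, List.mem_cons, not_or] at hn
  rw [tE_true G S hS p q r hp hq hr (by grind) (by grind) (by grind),
    tE_true G S hS p y z hp hy hz (by grind) (by grind) (by grind),
    tE_true G S hS q y z hq hy hz (by grind) (by grind) (by grind),
    tE_true G S hS r y z hr hy hz (by grind) (by grind) (by grind)] at h
  have sw : ∀ u w, tE G u v w = tE G w u v := fun u w => by
    rw [tE_swap23 G u v w, tE_swap12 G u w v]
  rw [sw p y, sw p z, sw q y, sw q z, sw r y, sw r z] at h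
  revert h
  cases tE G y p v <;> cases tE G y q v <;> cases tE G y r v <;> cases tE G z p v <;>
    cases tE G z q v <;> cases tE G z r v <;> simp

set_option maxHeartbeats 2000000 in
theorem ten_le (G : Finset (Finset V)) (hfree : F33Free G) (S : Finset V)
    (hS : S.powersetCard 3 ⊆ G) (a b c d e v : V) (hv : v ∉ S)
    (ha : a ∈ S) (hb : b ∈ S) (hc : c ∈ S) (hd : d ∈ S) (he : e ∈ S)
    (hn : [a, b, c, d, e].Nodup) :
    (tE G a b v).toNat + (tE G a c v).toNat + (tE G a d v).toNat + (tE G a e v).toNat +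
    (tE G b c v).toNat + (tE G b d v).toNat + (tE G b e v).toNat + (tE G c d v).toNat +
    (tE G c e v).toNat + (tE G d e v).toNat ≤ 6 := by
  have T := fun x y z s t hx hy hz hs ht hn =>
    tri_edge G hfree S hS v x y z s t hv hx hy hz hs ht hn
  have K := fun y z p q r hy hz hp hq hr hn =>
    k23 G hfree S hS v y z p q r hv hy hz hp hq hr hn
  have sw : ∀ x y, tE G x y v = tE G y x v := fun x y => tE_swap12 G x y v
  simp only [List.nodup_cons, List.mem_cons, not_or] at hn
  have t1 := T a b c d e ha hb hc hd he (by simp; grind)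
  have t2 := T a b d c e ha hb hd hc he (by simp; grind)
  have t3 := T a b e c d ha hb he hc hd (by simp; grind)
  have t4 := T a c d b e ha hc hd hb he (by simp; grind)
  have t5 := T a c e b d ha hc he hb hd (by simp; grind)
  have t6 := T a d e b c ha hd he hb hc (by simp; grind)
  have t7 := T b c d a e hb hc hd ha he (by simp; grind)
  have t8 := T b c e a d hb hc he ha hd (by simp; grind)
  have t9 := T b d e a c hb hd he ha hc (by simp; grind)
  have t10 := T c d e a b hc hd he ha hb (by simp; grind)
  have k1 := K a b c d e ha hb hc hd he (by simp; grind)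
  have k2 := K a c b d e ha hc hb hd he (by simp; grind)
  have k3 := K a d b c e ha hd hb hc he (by simp; grind)
  have k4 := K a e b c d ha he hb hc hd (by simp; grind)
  have k5 := K b c a d e hb hc ha hd he (by simp; grind)
  have k6 := K b d a c e hb hd ha hc he (by simp; grind)
  have k7 := K b e a c d hb he ha hc hd (by simp; grind)
  have k8 := K c d a b e hc hd ha hb he (by simp; grind)
  have k9 := K c e a b d hc he ha hb hd (by simp; grind)
  have k10 := K d e a b c hd he ha hb hc (by simp; grind)
  rw [sw c b] at k2
  rw [sw d b, sw d c] at k3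
  rw [sw e b, sw e c, sw e d] at k4
  rw [sw b a, sw c a] at k5
  rw [sw b a, sw d a, sw d c] at k6
  rw [sw b a, sw e a, sw e c, sw e d] at k7
  rw [sw c a, sw c b, sw d a, sw d b] at k8
  rw [sw c a, sw c b, sw e a, sw e b, sw e d] at k9
  rw [sw d a, sw d b, sw d c, sw e a, sw e b, sw e c] at k10
  apply bool_aux
  simp only [Bool.or_eq_false_iff]
  refine ⟨⟨⟨⟨⟨⟨⟨⟨⟨⟨⟨⟨⟨⟨⟨⟨⟨⟨⟨t1, ?_⟩, ?_⟩, ?_⟩, ?_⟩, ?_⟩, ?_⟩, ?_⟩, ?_⟩, ?_⟩, ?_⟩, ?_⟩, ?_⟩, ?_⟩, ?_⟩, ?_⟩, ?_⟩,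
    ?_⟩, ?_⟩, ?_⟩ <;> assumption

theorem k4step (G : Finset (Finset V)) (h3 : ∀ e ∈ G, e.card = 3) (hfree : F33Free G)
    (S W : Finset V) (hS : S.powersetCard 3 ⊆ G) (hSW : S ⊆ W) (a b c d : V)
    (ha : a ∈ S) (hb : b ∈ S) (hc : c ∈ S) (hd : d ∈ S) (hn : [a, b, c, d].Nodup) :
    eIn G W ≤ eIn G (W \ {a, b, c, d}) +
      (3 * (#W - 4).choose 2 + (#W - 4) / 2) + ∑ x ∈ W \ {a, b, c, d}, hP G a b c d x + 4 := by
  have hn' := hn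
  simp only [List.nodup_cons, List.mem_cons, not_or, List.not_mem_nil] at hn'
  have hsub : ({a, b, c, d} : Finset V) ⊆ W := by
    intro w hw
    simp only [mem_insert, mem_singleton] at hw
    rcases hw with rfl | rfl | rfl | rfl <;> exact hSW (by assumption)
  have hc4 : #({a, b, c, d} : Finset V) = 4 := by
    have := List.toFinset_card_of_nodup hn
    simpa using this
  have hcW : #(W \ {a, b, c, d}) = #W - 4 := by
    rw [card_sdiff_of_subset hsub, hc4]
  have hW : insert a (insert b (insert c (insert d (W \ {a, b, c, d})))) = W := by
    ext w
    have := @hsub w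
    simp only [mem_insert, mem_singleton, mem_sdiff] at this ⊢
    tauto
  have t1 := tE_true G S hS a b c ha hb hc (by grind) (by grind) (by grind)
  have t2 := tE_true G S hS a b d ha hb hd (by grind) (by grind) (by grind)
  have t3 := tE_true G S hS a c d ha hc hd (by grind) (by grind) (by grind)
  have t4 := tE_true G S hS b c d hb hc hd (by grind) (by grind) (by grind)
  have E := expand4 G h3 a b c d (W \ {a, b, c, d}) (by grind) (by grind) (by grind) (by grind)
    (by grind) (by grind) (by simp) (by simp) (by simp) (by simp)
  have L := lP_le G h3 hfree a b c d hn t1 t2 t3 t4 _ (W \ {a, b, c, d}) hcW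
    (by simp) (by simp) (by simp) (by simp)
  rw [hW, t1, t2, t3, t4] at E
  simp only [Bool.toNat_true] at E
  omega

theorem sdiff4 (W : Finset V) (a b c d : V) (hn : [a, b, c, d].Nodup)
    (ha : a ∈ W) (hb : b ∈ W) (hc : c ∈ W) (hd : d ∈ W) :
    #(W \ {a, b, c, d}) = #W - 4 := by
  rw [card_sdiff_of_subset]
  · have := List.toFinset_card_of_nodup hn
    simp only [List.toFinset_cons, List.toFinset_nil, insert_empty_eq, List.length_cons,
      List.length_nil] at this
    rw [this]
  · intro w hw
    simp only [mem_insert, mem_singleton] at hw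
    rcases hw with rfl | rfl | rfl | rfl <;> assumption

theorem exists4 (S : Finset V) (h : #S = 4) : ∃ a b c d, [a, b, c, d].Nodup ∧ S = {a, b, c, d} := by
  obtain ⟨a, b, c, d, h1, h2, h3, h4, h5, h6, rfl⟩ := card_eq_four.1 h
  exact ⟨a, b, c, d, by simp; tauto, rfl⟩

theorem exists5 (S : Finset V) (h : #S = 5) :
    ∃ a b c d e, [a, b, c, d, e].Nodup ∧ S = {a, b, c, d, e} := by
  obtain ⟨a, S', ha, rfl, h'⟩ := card_eq_succ.1 h
  obtain ⟨b, c, d, e, hn, rfl⟩ := exists4 S' h'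
  refine ⟨a, b, c, d, e, ?_, rfl⟩
  rw [List.nodup_cons]
  refine ⟨?_, hn⟩
  simpa using ha

theorem K5sum (G : Finset (Finset V)) (S W : Finset V) (hS : S.powersetCard 3 ⊆ G) (hSW : S ⊆ W)
    (a b c d e : V) (hS' : S = {a, b, c, d, e}) (hn : [a, b, c, d, e].Nodup) :
    ∑ x ∈ W \ {a, b, c, d}, hP G a b c d x = 6 + ∑ x ∈ W \ S, hP G a b c d x := by
  have hn' := hn
  simp only [List.nodup_cons, List.mem_cons, not_or, List.not_mem_nil] at hn'
  have ha : a ∈ S := by simp [hS']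
  have hb : b ∈ S := by simp [hS']
  have hc : c ∈ S := by simp [hS']
  have hd : d ∈ S := by simp [hS']
  have he : e ∈ S := by simp [hS']
  have h1 : W \ {a, b, c, d} = insert e (W \ S) := by
    ext w
    have h2 : w = e → w ∈ W := by rintro rfl; exact hSW he
    have h4 : w = e → ¬ (w = a ∨ w = b ∨ w = c ∨ w = d) := by rintro rfl; grind
    simp only [hS', mem_sdiff, mem_insert, mem_singleton]
    tauto
  rw [h1, sum_insert (by simp [he])]
  congr 1
  unfold hP
  rw [tE_true G S hS a b e ha hb he (by grind) (by grind) (by grind),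
    tE_true G S hS a c e ha hc he (by grind) (by grind) (by grind),
    tE_true G S hS a d e ha hd he (by grind) (by grind) (by grind),
    tE_true G S hS b c e hb hc he (by grind) (by grind) (by grind),
    tE_true G S hS b d e hb hd he (by grind) (by grind) (by grind),
    tE_true G S hS c d e hc hd he (by grind) (by grind) (by grind)]
  rfl

theorem K5choose (G : Finset (Finset V)) (hfree : F33Free G)
    (S W : Finset V) (hS : S.powersetCard 3 ⊆ G) (hSW : S ⊆ W) (h5 : #S = 5) :
    ∃ a b c d, a ∈ S ∧ b ∈ S ∧ c ∈ S ∧ d ∈ S ∧ [a, b, c, d].Nodup ∧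
      5 * ∑ x ∈ W \ {a, b, c, d}, hP G a b c d x ≤ 30 + 18 * (#W - 5) := by
  obtain ⟨a, b, c, d, e, hn, hS'⟩ := exists5 S h5
  have ha : a ∈ S := by simp [hS']
  have hb : b ∈ S := by simp [hS']
  have hc : c ∈ S := by simp [hS']
  have hd : d ∈ S := by simp [hS']
  have he : e ∈ S := by simp [hS']
  have hn' := hn
  simp only [List.nodup_cons, List.mem_cons, not_or, List.not_mem_nil] at hn'
  have s1 := K5sum G S W hS hSW a b c d e hS' hn
  have s2 := K5sum G S W hS hSW a b c e d (by rw [hS']; ext; simp; tauto) (by simp; grind)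
  have s3 := K5sum G S W hS hSW a b d e c (by rw [hS']; ext; simp; tauto) (by simp; grind)
  have s4 := K5sum G S W hS hSW a c d e b (by rw [hS']; ext; simp; tauto) (by simp; grind)
  have s5 := K5sum G S W hS hSW b c d e a (by rw [hS']; ext; simp; tauto) (by simp; grind)
  have key : ∑ x ∈ W \ S, (hP G a b c d x + hP G a b c e x + hP G a b d e x + hP G a c d e x +
      hP G b c d e x) ≤ ∑ x ∈ W \ S, 18 := by
    apply sum_le_sum
    intro x hx
    have := ten_le G hfree S hS a b c d e x (mem_sdiff.1 hx).2 ha hb hc hd he hn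
    unfold hP
    omega
  rw [sum_const, smul_eq_mul, card_sdiff_of_subset hSW, h5] at key
  simp only [sum_add_distrib] at key
  by_contra hcon
  push Not at hcon
  have c1 := hcon a b c d ha hb hc hd (by simp; grind)
  have c2 := hcon a b c e ha hb hc he (by simp; grind)
  have c3 := hcon a b d e ha hb hd he (by simp; grind)
  have c4 := hcon a c d e ha hc hd he (by simp; grind)
  have c5 := hcon b c d e hb hc hd he (by simp; grind)
  omega

theorem noK5 (G : Finset (Finset V)) (h3 : ∀ e ∈ G, e.card = 3)
    (S W : Finset V) (hS : S.powersetCard 3 ⊆ G) (hSW : S ⊆ W) (a b c d : V)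
    (hS' : S = {a, b, c, d}) (hn : [a, b, c, d].Nodup)
    (hK : ∀ S ⊆ W, #S = 5 → ¬ S.powersetCard 3 ⊆ G) (x : V) (hx : x ∈ W) (hxS : x ∉ S) :
    hP G a b c d x ≤ 5 := by
  have hn' := hn
  simp only [List.nodup_cons, List.mem_cons, not_or, List.not_mem_nil] at hn'
  have ha : a ∈ S := by simp [hS']
  have hb : b ∈ S := by simp [hS']
  have hc : c ∈ S := by simp [hS']
  have hd : d ∈ S := by simp [hS']
  have n1 : ∀ u ∈ S, u ∉ ({x} : Finset V) := fun u hu h => hxS (mem_singleton.1 h ▸ hu)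
  have E := expand4 G h3 a b c d {x} (by grind) (by grind) (by grind) (by grind)
    (by grind) (by grind) (n1 a ha) (n1 b hb) (n1 c hc) (n1 d hd)
  rw [tE_true G S hS a b c ha hb hc (by grind) (by grind) (by grind),
    tE_true G S hS a b d ha hb hd (by grind) (by grind) (by grind),
    tE_true G S hS a c d ha hc hd (by grind) (by grind) (by grind),
    tE_true G S hS b c d hb hc hd (by grind) (by grind) (by grind), sum_singleton] at E
  simp only [Bool.toNat_true] at E
  have hi : insert a (insert b (insert c (insert d {x}))) = insert x S := by
    rw [hS']; ext; simp; tauto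
  have h4 : #S = 4 := by
    have := List.toFinset_card_of_nodup hn
    rw [hS']
    simpa using this
  have h5 : #(insert x S) = 5 := by rw [card_insert_of_notMem hxS, h4]
  have hlt := eIn_lt G h3 (insert x S) (hK _ (insert_subset hx hSW) h5)
  rw [hi] at E
  rw [h5, show Nat.choose 5 3 = 10 by decide] at hlt
  omega

theorem main_aux (G : Finset (Finset V)) (h3 : ∀ e ∈ G, e.card = 3) (hfree : F33Free G) (n : ℕ) :
    n ≠ 5 → ∀ W : Finset V, #W = n → eIn G W ≤ b n := by
  induction n using Nat.strong_induction_on with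
  | _ n ih =>
  intro hn5 W hW
  by_cases hsm : n ≤ 4
  · have h := eIn_le G h3 W
    rw [hW] at h
    refine h.trans ?_
    interval_cases n <;> decide
  have hb9 : b 5 = 9 := by decide
  have hrec := b_rec (n - 4)
  rw [show n - 4 + 4 = n by omega] at hrec
  by_cases hK5 : ∀ S ⊆ W, #S = 5 → ¬ S.powersetCard 3 ⊆ G
  · by_cases hK4 : ∀ S ⊆ W, #S = 4 → ¬ S.powersetCard 3 ⊆ G
    · have h1 := k4free G h3 (n - 4) W (by omega) hK4
      rw [show n - 4 + 4 = n by omega] at h1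
      have h2 := b_ge n (by omega)
      omega
    · push Not at hK4
      obtain ⟨S, hSW, h4, hS⟩ := hK4
      obtain ⟨a, b', c, d, hn, hS'⟩ := exists4 S h4
      have ha : a ∈ S := by simp [hS']
      have hb : b' ∈ S := by simp [hS']
      have hc : c ∈ S := by simp [hS']
      have hd : d ∈ S := by simp [hS']
      have step := k4step G h3 hfree S W hS hSW a b' c d ha hb hc hd hn
      have hcard := sdiff4 W a b' c d hn (hSW ha) (hSW hb) (hSW hc) (hSW hd)
      have hsum : ∑ x ∈ W \ {a, b', c, d}, hP G a b' c d x ≤ ∑ x ∈ W \ {a, b', c, d}, 5 := by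
        apply sum_le_sum
        intro x hx
        rw [mem_sdiff] at hx
        exact noK5 G h3 S W hS hSW a b' c d hS' hn hK5 x hx.1 (by rw [hS']; exact hx.2)
      rw [sum_const, smul_eq_mul, hcard] at hsum
      rw [hW] at step hsum hcard
      have hrest : eIn G (W \ {a, b', c, d}) ≤ b (n - 4) := by
        by_cases h9 : n - 4 = 5
        · rw [h9] at hcard
          have := eIn_lt G h3 _ (hK5 _ sdiff_subset hcard)
          rw [hcard, show Nat.choose 5 3 = 10 by decide] at this
          rw [h9, hb9]
          omega
        · exact ih (n - 4) (by omega) h9 _ hcard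
      omega
  · push Not at hK5
    obtain ⟨S, hSW, h5, hS⟩ := hK5
    obtain ⟨a, b', c, d, ha, hb, hc, hd, hn, hsum⟩ := K5choose G hfree S W hS hSW h5
    have step := k4step G h3 hfree S W hS hSW a b' c d ha hb hc hd hn
    have hcard := sdiff4 W a b' c d hn (hSW ha) (hSW hb) (hSW hc) (hSW hd)
    rw [hW] at step hsum hcard
    by_cases h9 : n - 4 = 5
    · have := eIn_le G h3 (W \ {a, b', c, d})
      rw [hcard, h9, show Nat.choose 5 3 = 10 by decide] at this
      rw [h9] at hrec step
      omega
    · have := ih (n - 4) (by omega) h9 _ hcard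
      omega

end F33aux

theorem F33Free_card_le {V : Type*} [Fintype V] [DecidableEq V] (n : ℕ)
    (hn : 1 ≤ n) (h5 : n ≠ 5) (hcard : Fintype.card V = n)
    (G : Finset (Finset V)) (h3 : ∀ e ∈ G, e.card = 3) (hfree : F33Free G) :
    G.card ≤ b n := by
  have h := main_aux G h3 hfree n h5 Finset.univ (by rw [Finset.card_univ, hcard])
  have e : eIn G Finset.univ = G.card := by
    unfold eIn
    rw [Finset.filter_true_of_mem]
    intro t _
    exact Finset.subset_univ t
  rw [e] at h
  exact h
end

section
/- Every F_{3,3}-free 3-graph on 6 vertices with exactly 18 = C(6,3) − 2 edges is isomorphic to B(6), the complete bipartite 3-graph with two parts of size 3 (whose edges are all triples not contained within either part). -/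
/-- The complete bipartite 3-graph `B(6)` on `Fin 6`, with parts
`{0,1,2}` and `{3,4,5}`: the edges are all triples not contained in either part. -/
def B6 : Finset (Finset (Fin 6)) :=
  (Finset.univ.powersetCard 3).filter
    (fun e => ¬ (∀ v ∈ e, (v : ℕ) < 3) ∧ ¬ (∀ v ∈ e, 3 ≤ (v : ℕ)))

theorem hasF33_aux {V : Type*} [DecidableEq V] (G : Finset (Finset V)) (A B : Finset V)
    (hG : ∀ e : Finset V, e.card = 3 → e ≠ A → e ≠ B → e ∈ G)
    (a b c x y z : V) (hn : [a, b, c, x, y, z].Nodup)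
    (hA : A = {x, y, z} ∨ A = {a, b, x} ∨ A = {a, b, y})
    (hB : B = {a, b, x} ∨ B = {a, b, y}) : HasF33 G := by
  simp only [List.nodup_cons, List.mem_cons, List.not_mem_nil, or_false, not_or] at hn
  obtain ⟨⟨h1, h2, h3, h4, h5⟩, ⟨h6, h7, h8, h9⟩, ⟨h10, h11, h12⟩, ⟨h13, h14⟩, h15, -⟩ := hn
  have key : ∀ p q r : V, p ≠ q → p ≠ r → q ≠ r → (∃ w ∈ A, w ∉ ({p, q, r} : Finset V)) →
      (∃ w ∈ B, w ∉ ({p, q, r} : Finset V)) → ({p, q, r} : Finset V) ∈ G := by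
    intro p q r hpq hpr hqr ⟨w, hw, hw'⟩ ⟨v, hv, hv'⟩
    refine hG _ (Finset.card_eq_three.2 ⟨p, q, r, hpq, hpr, hqr, rfl⟩) ?_ ?_
    · rintro h; exact hw' (h ▸ hw)
    · rintro h; exact hv' (h ▸ hv)
  refine ⟨a, b, c, x, y, z, ?_, ?_, ?_, ?_, ?_, ?_, ?_, ?_, ?_, ?_, ?_⟩
  · simp [*]
  all_goals
    apply key <;> first | assumption | skip
  all_goals
    rcases hA with rfl | rfl | rfl <;> rcases hB with rfl | rfl <;> simp <;> grind

set_option maxHeartbeats 1000000 in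
/-- Every `F₃,₃`-free 3-graph on 6 vertices with `18 = C(6,3) - 2` edges is
isomorphic to `B(6)`. -/
theorem F33Free_eighteen_edges_iso_B6 {V : Type*} [Fintype V] [DecidableEq V]
    (hV : Fintype.card V = 6) (G : Finset (Finset V))
    (h3 : ∀ e ∈ G, e.card = 3) (hfree : F33Free G) (hcard : G.card = 18) :
    ∃ φ : V ≃ Fin 6, ∀ e : Finset V, e ∈ G ↔ e.image φ ∈ B6 := by
  obtain ⟨A, B, hAB, hM⟩ : ∃ A B, A ≠ B ∧ Finset.univ.powersetCard 3 \ G = {A, B} := by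
    rw [← Finset.card_eq_two, Finset.card_sdiff_of_subset, Finset.card_powersetCard,
      Finset.card_univ, hV, hcard]
    · rfl
    · intro e he
      simp [h3 e he]
  have hmem : ∀ e : Finset V, e.card = 3 ∧ e ∉ G ↔ e = A ∨ e = B := by
    intro e
    have := congrArg (fun s => e ∈ s) hM
    simpa only [Finset.mem_sdiff, Finset.mem_powersetCard, Finset.subset_univ, true_and,
      Finset.mem_insert, Finset.mem_singleton, eq_iff_iff] using this
  have hA := ((hmem A).2 (Or.inl rfl)).1
  have hB := ((hmem B).2 (Or.inr rfl)).1
  have hG : ∀ e : Finset V, e.card = 3 → e ≠ A → e ≠ B → e ∈ G := by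
    intro e h1 h2 h3
    by_contra h
    rcases (hmem e).1 ⟨h1, h⟩ with h | h <;> contradiction
  have hi1 := Finset.card_inter_add_card_sdiff A B
  have hi2 := Finset.card_inter_add_card_sdiff B A
  have hi3 := Finset.card_union_add_card_inter A B
  have hi4 := Finset.card_add_card_compl (A ∪ B)
  rw [Finset.inter_comm B A] at hi2
  have hlt : (A ∩ B).card ≠ 3 := by
    intro h
    have e1 := Finset.eq_of_subset_of_card_le (Finset.inter_subset_left (s₁ := A) (s₂ := B))
      (by omega)
    have e2 := Finset.eq_of_subset_of_card_le (Finset.inter_subset_right (s₁ := A) (s₂ := B))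
      (by omega)
    exact hAB (e1.symm.trans e2)
  have hc : (A ∩ B).card = 0 ∨ (A ∩ B).card = 1 ∨ (A ∩ B).card = 2 := by omega
  rcases hc with hc | hc | hc
  · have hBc : ∀ v, v ∈ B ↔ v ∉ A := by
      have hd : Disjoint A B := Finset.disjoint_iff_inter_eq_empty.2 (Finset.card_eq_zero.1 hc)
      have : (A ∪ B)ᶜ = ∅ := Finset.card_eq_zero.1 (by omega)
      intro v
      have h1 : v ∉ (A ∪ B)ᶜ := by simp [this]
      have h2 : v ∈ A → v ∉ B := fun h => Finset.disjoint_left.1 hd h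
      rw [Finset.mem_compl, Finset.mem_union] at h1
      tauto
    obtain ⟨φ, hφ⟩ : ∃ φ : V ≃ Fin 6, ∀ v, (φ v : ℕ) < 3 ↔ v ∈ A := by
      have e1 : {v // v ∈ A} ≃ {i : Fin 6 // (i : ℕ) < 3} :=
        Fintype.equivOfCardEq (by rw [Fintype.card_coe, hA]; decide)
      have e2 : {v // ¬ v ∈ A} ≃ {i : Fin 6 // ¬ (i : ℕ) < 3} :=
        Fintype.equivOfCardEq (by
          rw [Fintype.card_subtype_compl, Fintype.card_coe, hA, hV]; decide)
      refine ⟨(Equiv.sumCompl (· ∈ A)).symm.trans ((Equiv.sumCongr e1 e2).trans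
        (Equiv.sumCompl (fun i : Fin 6 => (i : ℕ) < 3))), fun v => ?_⟩
      by_cases hv : v ∈ A
      · simpa [hv, Equiv.sumCompl_symm_apply_of_pos] using (e1 ⟨v, hv⟩).2
      · simpa [hv, Equiv.sumCompl_symm_apply_of_neg] using (e2 ⟨v, hv⟩).2
    refine ⟨φ, fun e => ?_⟩
    have hB6 : e.image φ ∈ B6 ↔ e.card = 3 ∧ ¬ e ⊆ A ∧ ¬ e ⊆ B := by
      have h1 : (∀ v ∈ e.image φ, (v : ℕ) < 3) ↔ e ⊆ A := by
        simp [Finset.subset_iff, hφ]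
      have h2 : (∀ v ∈ e.image φ, 3 ≤ (v : ℕ)) ↔ e ⊆ B := by
        simp only [Finset.forall_mem_image, Finset.subset_iff, hBc, ← hφ, not_lt]
      rw [B6, Finset.mem_filter, h1, h2, Finset.mem_powersetCard,
        Finset.card_image_of_injective _ φ.injective]
      simp
    rw [hB6]
    constructor
    · intro he
      refine ⟨h3 e he, fun h => ?_, fun h => ?_⟩
      · exact ((hmem e).2 (Or.inl (Finset.eq_of_subset_of_card_le h (by rw [h3 e he, hA])))).2 he
      · exact ((hmem e).2 (Or.inr (Finset.eq_of_subset_of_card_le h (by rw [h3 e he, hB])))).2 he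
    · rintro ⟨h1, h2, h3⟩
      exact hG e h1 (fun h => h2 h.subset) (fun h => h3 h.subset)
  · exfalso
    obtain ⟨p, hp⟩ := Finset.card_eq_one.1 hc
    obtain ⟨q, r, hqr, h1⟩ := Finset.card_eq_two.1 (show (A \ B).card = 2 by omega)
    obtain ⟨s, t, hst, h2⟩ := Finset.card_eq_two.1 (show (B \ A).card = 2 by omega)
    obtain ⟨u, h4⟩ := Finset.card_eq_one.1 (show (A ∪ B)ᶜ.card = 1 by omega)
    simp only [Finset.ext_iff, Finset.mem_inter, Finset.mem_sdiff, Finset.mem_compl,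
      Finset.mem_union, Finset.mem_insert, Finset.mem_singleton] at hp h1 h2 h4
    refine hfree (hasF33_aux G A B hG s t u p q r ?_ (Or.inl ?_) (Or.inl ?_))
    all_goals clear hM hmem hG hcard h3 hA hB hi1 hi2 hi3 hi4 hlt hc hAB hfree
    · have H := fun a => And.intro (hp a) (And.intro (h1 a) (And.intro (h2 a) (h4 a)))
      have := H p
      have := H q
      have := H r
      have := H s
      have := H t
      have := H u
      clear H hp h1 h2 h4
      simp
      grind
    · ext v
      have := hp v
      have := h1 v
      have := h2 v
      have := h4 v
      simp only [Finset.mem_insert, Finset.mem_singleton]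
      clear hp h1 h2 h4
      grind
    · ext v
      have := hp v
      have := h1 v
      have := h2 v
      have := h4 v
      simp only [Finset.mem_insert, Finset.mem_singleton]
      clear hp h1 h2 h4
      grind
  · exfalso
    obtain ⟨p, q, hpq, hp⟩ := Finset.card_eq_two.1 hc
    obtain ⟨r, h1⟩ := Finset.card_eq_one.1 (show (A \ B).card = 1 by omega)
    obtain ⟨s, h2⟩ := Finset.card_eq_one.1 (show (B \ A).card = 1 by omega)
    obtain ⟨t, u, htu, h4⟩ := Finset.card_eq_two.1 (show (A ∪ B)ᶜ.card = 2 by omega)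
    simp only [Finset.ext_iff, Finset.mem_inter, Finset.mem_sdiff, Finset.mem_compl,
      Finset.mem_union, Finset.mem_insert, Finset.mem_singleton] at hp h1 h2 h4
    refine hfree (hasF33_aux G A B hG p q t r s u ?_ (Or.inr (Or.inl ?_)) (Or.inr ?_))
    all_goals clear hM hmem hG hcard h3 hA hB hi1 hi2 hi3 hi4 hlt hc hAB hfree
    · have H := fun a => And.intro (hp a) (And.intro (h1 a) (And.intro (h2 a) (h4 a)))
      have := H p
      have := H q
      have := H r
      have := H s
      have := H t
      have := H u
      clear H hp h1 h2 h4
      simp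
      grind
    · ext v
      have := hp v
      have := h1 v
      have := h2 v
      have := h4 v
      simp only [Finset.mem_insert, Finset.mem_singleton]
      clear hp h1 h2 h4
      grind
    · ext v
      have := hp v
      have := h1 v
      have := h2 v
      have := h4 v
      simp only [Finset.mem_insert, Finset.mem_singleton]
      clear hp h1 h2 h4
      grind
end
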